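/- arXiv:1412.3286 — 3 statements merged into one kernel-verified Lean document; each statement's English description precedes it below -/
import Mathlib

section
/- Let d ≥ 2 be an integer and let c be a fixed d-cycle in the symmetric group S_d (i.e. a permutation of {1,…,d} consisting of a single cycle through all d points). Then the number of ordered (d−1)-tuples (τ_1, …, τ_{d−1}) of transpositions in S_d satisfying τ_1 · τ_2 ⋯ τ_{d−1} = c equals d^(d−2). -/
section CycleClasses

open Equiv Equiv.Perm Finset

variable {α : Type*}

theorem sameCycle_of_forall_sameCycle_apply [Finite α] {σ τ : Perm α}
    (h : ∀ z, τ.SameCycle z (σ z)) {u v : α} (huv : σ.SameCycle u v) : τ.SameCycle u v := by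
  obtain ⟨n, -, rfl⟩ := huv.exists_pow_eq'
  clear huv
  induction n with
  | zero => simpa using SameCycle.refl τ u
  | succ n ih =>
    rw [pow_succ', Perm.mul_apply]
    exact ih.trans (h _)

variable [Fintype α] [DecidableEq α]

/-- The points of the cycle of `σ` through `x`. -/
def cycleClass (σ : Perm α) (x : α) : Finset α := {y | σ.SameCycle x y}

/-- The orbits of `σ`, fixed points included. -/
def cycleClasses (σ : Perm α) : Finset (Finset α) := univ.image (cycleClass σ)

theorem mem_cycleClass {σ : Perm α} {x y : α} : y ∈ cycleClass σ x ↔ σ.SameCycle x y := by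
  simp [cycleClass]

theorem cycleClass_eq_iff {σ : Perm α} {x y : α} :
    cycleClass σ x = cycleClass σ y ↔ σ.SameCycle x y := by
  refine ⟨fun h => ?_, fun h => ?_⟩
  · rw [← mem_cycleClass, h, mem_cycleClass]
  · ext z
    rw [mem_cycleClass, mem_cycleClass]
    exact ⟨h.symm.trans, h.trans⟩

theorem cycleClass_card_pos (σ : Perm α) (x : α) : 0 < #(cycleClass σ x) :=
  card_pos.2 ⟨x, mem_cycleClass.2 (SameCycle.refl σ x)⟩

/-- If `x` and `y` lie on the same cycle of `σ`, the cycles of `σ * swap x y` refine those of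
`σ`. -/
theorem Equiv.Perm.SameCycle.of_mul_swap {σ : Perm α} {x y : α} (hxy : σ.SameCycle x y) {u v : α}
    (h : (σ * swap x y).SameCycle u v) : σ.SameCycle u v := by
  refine sameCycle_of_forall_sameCycle_apply (fun z => ?_) h
  rw [Perm.mul_apply, sameCycle_apply_right]
  by_cases hx : z = x
  · subst hx; simpa using hxy
  by_cases hy : z = y
  · subst hy; simpa using hxy.symm
  rw [swap_apply_of_ne_of_ne hx hy]

theorem sameCycle_mul_swap {σ : Perm α} {x y : α} (hxy : ¬ σ.SameCycle x y) :
    (σ * swap x y).SameCycle x y := by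
  by_contra hcon
  have key : ∀ j : ℕ, (σ * swap x y).SameCycle x ((σ ^ (j + 1)) y) := by
    intro j
    induction j with
    | zero =>
      have : (σ ^ (0 + 1)) y = (σ * swap x y) x := by simp
      rw [this, sameCycle_apply_right]
    | succ j ih =>
      have hx : (σ ^ (j + 1)) y ≠ x := fun e =>
        hxy (SameCycle.symm (e ▸ SameCycle.pow_right (SameCycle.refl σ y)))
      have hy : (σ ^ (j + 1)) y ≠ y := fun e => hcon (by rwa [e] at ih)
      have : (σ ^ (j + 1 + 1)) y = (σ * swap x y) ((σ ^ (j + 1)) y) := by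
        rw [Perm.mul_apply, swap_apply_of_ne_of_ne hx hy, pow_succ' _ (j + 1), Perm.mul_apply]
      rw [this, sameCycle_apply_right]
      exact ih
  have h := key (orderOf σ - 1)
  rw [Nat.sub_add_cancel (orderOf_pos σ), pow_orderOf_eq_one] at h
  exact hcon h

/-- If `x` and `y` lie on different cycles of `σ`, then `σ * swap x y` merges these. -/
theorem sameCycle_mul_swap_iff {σ : Perm α} {x y : α} (hxy : ¬ σ.SameCycle x y) {u v : α} :
    (σ * swap x y).SameCycle u v ↔ σ.SameCycle u v ∨
      (σ.SameCycle x u ∨ σ.SameCycle y u) ∧ (σ.SameCycle x v ∨ σ.SameCycle y v) := by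
  have hτ := sameCycle_mul_swap hxy
  have mono : ∀ {u v}, σ.SameCycle u v → (σ * swap x y).SameCycle u v := by
    intro u v h
    refine SameCycle.of_mul_swap hτ ?_
    rwa [mul_assoc, swap_mul_self, mul_one]
  constructor
  · intro h
    obtain ⟨n, -, rfl⟩ := h.exists_pow_eq'
    clear h
    induction n with
    | zero => exact Or.inl (SameCycle.refl σ u)
    | succ n ih =>
      rw [pow_succ', Perm.mul_apply, Perm.mul_apply]
      generalize ((σ * swap x y) ^ n) u = w at *
      simp only [sameCycle_apply_right]
      by_cases hx : w = x
      · subst hx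
        rw [swap_apply_left]
        rcases ih with h | h
        · exact Or.inr ⟨Or.inl h.symm, Or.inr (SameCycle.refl _ _)⟩
        · exact Or.inr ⟨h.1, Or.inr (SameCycle.refl _ _)⟩
      by_cases hy : w = y
      · subst hy
        rw [swap_apply_right]
        rcases ih with h | h
        · exact Or.inr ⟨Or.inr h.symm, Or.inl (SameCycle.refl _ _)⟩
        · exact Or.inr ⟨h.1, Or.inl (SameCycle.refl _ _)⟩
      rwa [swap_apply_of_ne_of_ne hx hy]
  · rintro (h | ⟨hu, hv⟩)
    · exact mono h
    · have aux : ∀ {w}, σ.SameCycle x w ∨ σ.SameCycle y w → (σ * swap x y).SameCycle x w := by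
        rintro w (h | h)
        · exact mono h
        · exact hτ.trans (mono h)
      exact (aux hu).symm.trans (aux hv)

theorem cycleClass_mul_swap {σ : Perm α} {x y : α} (hxy : ¬ σ.SameCycle x y) (u : α) :
    cycleClass (σ * swap x y) u =
      if σ.SameCycle x u ∨ σ.SameCycle y u then cycleClass σ x ∪ cycleClass σ y
      else cycleClass σ u := by
  ext v
  rw [mem_cycleClass, sameCycle_mul_swap_iff hxy]
  split_ifs with h
  · simp only [mem_union, mem_cycleClass]
    refine ⟨?_, fun hv => Or.inr ⟨h, hv⟩⟩
    rintro (huv | ⟨-, hv⟩)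
    · exact h.imp (·.trans huv) (·.trans huv)
    · exact hv
  · simp [h, mem_cycleClass]

theorem cycleClasses_mul_swap {σ : Perm α} {x y : α} (hxy : ¬ σ.SameCycle x y) :
    cycleClasses (σ * swap x y) = insert (cycleClass σ x ∪ cycleClass σ y)
      (((cycleClasses σ).erase (cycleClass σ x)).erase (cycleClass σ y)) := by
  ext s
  simp only [cycleClasses, mem_image, mem_univ, true_and, mem_insert, mem_erase,
    cycleClass_mul_swap hxy]
  constructor
  · rintro ⟨u, rfl⟩
    split_ifs with h
    · exact Or.inl rfl
    · push Not at h
      refine Or.inr ⟨fun e => h.2 (cycleClass_eq_iff.1 e).symm,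
        fun e => h.1 (cycleClass_eq_iff.1 e).symm, u, rfl⟩
  · rintro (rfl | ⟨hy, hx, u, rfl⟩)
    · exact ⟨x, if_pos (Or.inl (SameCycle.refl σ x))⟩
    · refine ⟨u, if_neg ?_⟩
      rintro (h | h)
      · exact hx (cycleClass_eq_iff.2 h.symm)
      · exact hy (cycleClass_eq_iff.2 h.symm)

theorem union_cycleClass_notMem {σ : Perm α} {x y : α} (hxy : ¬ σ.SameCycle x y) :
    cycleClass σ x ∪ cycleClass σ y ∉
      ((cycleClasses σ).erase (cycleClass σ x)).erase (cycleClass σ y) := by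
  simp only [cycleClasses, mem_image, mem_univ, true_and, mem_erase]
  rintro ⟨-, -, u, hu⟩
  have hx : x ∈ cycleClass σ u := hu ▸ mem_union_left _ (mem_cycleClass.2 (SameCycle.refl _ _))
  have hy : y ∈ cycleClass σ u := hu ▸ mem_union_right _ (mem_cycleClass.2 (SameCycle.refl _ _))
  exact hxy ((mem_cycleClass.1 hx).symm.trans (mem_cycleClass.1 hy))

theorem cycleClass_mem_cycleClasses (σ : Perm α) (x : α) : cycleClass σ x ∈ cycleClasses σ :=
  mem_image_of_mem _ (mem_univ x)

theorem cycleClass_mem_erase {σ : Perm α} {x y : α} (hxy : ¬ σ.SameCycle x y) :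
    cycleClass σ y ∈ (cycleClasses σ).erase (cycleClass σ x) :=
  mem_erase.2 ⟨fun e => hxy (cycleClass_eq_iff.1 e).symm, cycleClass_mem_cycleClasses σ y⟩

theorem card_cycleClasses_mul_swap {σ : Perm α} {x y : α} (hxy : ¬ σ.SameCycle x y) :
    #(cycleClasses (σ * swap x y)) + 1 = #(cycleClasses σ) := by
  rw [cycleClasses_mul_swap hxy, card_insert_of_notMem (union_cycleClass_notMem hxy),
    card_erase_add_one (cycleClass_mem_erase hxy),
    card_erase_add_one (cycleClass_mem_cycleClasses σ x)]

theorem card_cycleClasses_le_mul_swap {σ : Perm α} {x y : α} (hxy : σ.SameCycle x y) :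
    #(cycleClasses σ) ≤ #(cycleClasses (σ * swap x y)) := by
  have h : cycleClasses σ =
      (cycleClasses (σ * swap x y)).image fun s => s.biUnion (cycleClass σ) := by
    rw [cycleClasses, cycleClasses, image_image]
    refine image_congr fun u _ => ?_
    ext v
    simp only [Function.comp_apply, mem_biUnion, mem_cycleClass]
    exact ⟨fun h => ⟨u, SameCycle.refl _ _, h⟩,
      fun ⟨w, hw, h⟩ => (SameCycle.of_mul_swap hxy hw).trans h⟩
  rw [h]
  exact card_image_le

/-- The product of the cycle lengths of `σ`. -/
def cycleLengthProd (σ : Perm α) : ℕ := ∏ s ∈ cycleClasses σ, #s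

theorem cycleLengthProd_mul_swap {σ : Perm α} {x y : α} (hxy : ¬ σ.SameCycle x y) :
    (cycleLengthProd (σ * swap x y) : ℚ) =
      cycleLengthProd σ * ((#(cycleClass σ x) : ℚ)⁻¹ + (#(cycleClass σ y) : ℚ)⁻¹) := by
  have hdisj : Disjoint (cycleClass σ x) (cycleClass σ y) := by
    rw [disjoint_left]
    intro z hx hy
    exact hxy ((mem_cycleClass.1 hx).trans (mem_cycleClass.1 hy).symm)
  have hx : (#(cycleClass σ x) : ℚ) ≠ 0 := by exact_mod_cast (cycleClass_card_pos σ x).ne'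
  have hy : (#(cycleClass σ y) : ℚ) ≠ 0 := by exact_mod_cast (cycleClass_card_pos σ y).ne'
  rw [cycleLengthProd, cycleLengthProd, cycleClasses_mul_swap hxy,
    prod_insert (union_cycleClass_notMem hxy), card_union_of_disjoint hdisj,
    ← mul_prod_erase _ _ (cycleClass_mem_cycleClasses σ x),
    ← mul_prod_erase _ _ (cycleClass_mem_erase hxy)]
  push_cast
  field_simp
  ring

theorem sum_inv_card_cycleClass (σ : Perm α) :
    ∑ x, (#(cycleClass σ x) : ℚ)⁻¹ = #(cycleClasses σ) := by
  rw [← sum_fiberwise_of_maps_to (fun x _ => cycleClass_mem_cycleClasses σ x),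
    card_eq_sum_ones, Nat.cast_sum]
  refine sum_congr rfl fun s hs => ?_
  obtain ⟨x, -, rfl⟩ := mem_image.1 hs
  have hfib : ({z | cycleClass σ z = cycleClass σ x} : Finset α) = cycleClass σ x := by
    ext z
    simp only [mem_filter, mem_univ, true_and, mem_cycleClass, cycleClass_eq_iff]
    exact sameCycle_comm
  rw [sum_congr rfl fun z hz => by rw [(mem_filter.1 hz).2], hfib, sum_const, nsmul_eq_mul,
    mul_inv_cancel₀ (by exact_mod_cast (cycleClass_card_pos σ x).ne'), Nat.cast_one]

theorem sum_cycleLengthProd_mul_swap (σ : Perm α) :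
    ∑ p : α × α with ¬ σ.SameCycle p.1 p.2, (cycleLengthProd (σ * swap p.1 p.2) : ℚ) =
      2 * Fintype.card α * (#(cycleClasses σ) - 1) * cycleLengthProd σ := by
  have half : ∑ x, ∑ y, (if ¬ σ.SameCycle x y then (#(cycleClass σ x) : ℚ)⁻¹ else 0) =
      Fintype.card α * (#(cycleClasses σ) - 1) := by
    have : ∀ x, ∑ y, (if ¬ σ.SameCycle x y then (#(cycleClass σ x) : ℚ)⁻¹ else 0) =
        Fintype.card α * (#(cycleClass σ x) : ℚ)⁻¹ - 1 := by
      intro x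
      have hx : (#(cycleClass σ x) : ℚ) ≠ 0 := by exact_mod_cast (cycleClass_card_pos σ x).ne'
      have h1 : ∀ y, (if ¬ σ.SameCycle x y then (#(cycleClass σ x) : ℚ)⁻¹ else 0) =
          (#(cycleClass σ x) : ℚ)⁻¹ -
            if y ∈ cycleClass σ x then (#(cycleClass σ x) : ℚ)⁻¹ else 0 := by
        intro y
        by_cases h : σ.SameCycle x y <;> simp [h, mem_cycleClass]
      simp only [h1, sum_sub_distrib, sum_const, sum_ite_mem, univ_inter, nsmul_eq_mul, card_univ,
        mul_inv_cancel₀ hx]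
    simp only [this, sum_sub_distrib, ← mul_sum, sum_inv_card_cycleClass, sum_const, card_univ,
      nsmul_eq_mul]
    ring
  have half' : ∑ x, ∑ y, (if ¬ σ.SameCycle x y then (#(cycleClass σ y) : ℚ)⁻¹ else 0) =
      Fintype.card α * (#(cycleClasses σ) - 1) := by
    rw [sum_comm, ← half]
    simp only [sameCycle_comm]
  rw [sum_congr rfl fun p hp => cycleLengthProd_mul_swap (mem_filter.1 hp).2, ← mul_sum,
    sum_filter, Fintype.sum_prod_type]
  have : ∀ x y, (if ¬ σ.SameCycle x y then
      (#(cycleClass σ x) : ℚ)⁻¹ + (#(cycleClass σ y) : ℚ)⁻¹ else 0) =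
      (if ¬ σ.SameCycle x y then (#(cycleClass σ x) : ℚ)⁻¹ else 0) +
      (if ¬ σ.SameCycle x y then (#(cycleClass σ y) : ℚ)⁻¹ else 0) := by
    intro x y
    split_ifs <;> simp
  simp only [this, sum_add_distrib, half, half']
  ring

/-- The transpositions of `α`. -/
def transpositions (α : Type*) [Fintype α] [DecidableEq α] : Finset (Perm α) :=
  (univ : Finset α).offDiag.image fun p => swap p.1 p.2

theorem mem_transpositions {t : Perm α} : t ∈ transpositions α ↔ t.IsSwap := by
  simp [transpositions, IsSwap, eq_comm]

theorem sum_swap_offDiag (f : Perm α → ℕ) :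
    ∑ p ∈ (univ : Finset α).offDiag, f (swap p.1 p.2) = 2 * ∑ t ∈ transpositions α, f t := by
  rw [← sum_fiberwise_of_maps_to (g := fun p : α × α => swap p.1 p.2)
    (fun p hp => mem_image_of_mem _ hp), transpositions, mul_sum]
  refine sum_congr rfl fun t ht => ?_
  obtain ⟨⟨a, b⟩, hab, rfl⟩ := mem_image.1 ht
  replace hab : a ≠ b := by simpa using hab
  have hfib : ({p ∈ (univ : Finset α).offDiag | swap p.1 p.2 = swap a b} : Finset (α × α)) =
      {(a, b), (b, a)} := by
    ext ⟨x, y⟩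
    simp only [mem_filter, mem_offDiag, mem_univ, true_and, mem_insert, mem_singleton,
      Prod.mk.injEq]
    constructor
    · rintro ⟨hxy, h⟩
      have hx : swap a b x = y := by rw [← h, swap_apply_left]
      by_cases hxa : x = a
      · subst hxa
        rw [swap_apply_left] at hx
        exact Or.inl ⟨rfl, hx.symm⟩
      by_cases hxb : x = b
      · subst hxb
        rw [swap_apply_right] at hx
        exact Or.inr ⟨rfl, hx.symm⟩
      · rw [swap_apply_of_ne_of_ne hxa hxb] at hx
        exact absurd hx hxy
    · rintro (⟨rfl, rfl⟩ | ⟨rfl, rfl⟩)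
      · exact ⟨hab, rfl⟩
      · exact ⟨hab.symm, swap_comm _ _⟩
  rw [sum_congr rfl fun p hp => by rw [(mem_filter.1 hp).2], hfib, sum_const,
    card_pair (by simp [hab]), smul_eq_mul]

/-- The number of `m`-tuples of transpositions which, multiplied onto `σ`, give a permutation with
a single orbit. -/
def countJoining (m : ℕ) (σ : Perm α) : ℕ :=
  #{τ ∈ Fintype.piFinset fun _ : Fin m => transpositions α |
    #(cycleClasses (σ * (List.ofFn τ).prod)) = 1}

theorem countJoining_zero (σ : Perm α) :
    countJoining 0 σ = if #(cycleClasses σ) = 1 then 1 else 0 := by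
  simp only [countJoining, List.ofFn_zero, List.prod_nil, mul_one]
  split_ifs with h <;> simp [h]

theorem countJoining_succ (m : ℕ) (σ : Perm α) :
    countJoining (m + 1) σ = ∑ t ∈ transpositions α, countJoining m (σ * t) := by
  simp only [countJoining]
  rw [← card_sigma]
  refine card_bij' (fun τ _ => ⟨τ 0, Fin.tail τ⟩) (fun p _ => Fin.cons p.1 p.2) ?_ ?_ ?_ ?_
  · intro τ hτ
    rw [mem_filter, Fintype.mem_piFinset, List.ofFn_succ, List.prod_cons, ← mul_assoc] at hτ
    simp only [mem_sigma, mem_filter, Fintype.mem_piFinset]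
    exact ⟨hτ.1 0, fun i => hτ.1 i.succ, hτ.2⟩
  · rintro ⟨t, τ⟩ hτ
    simp only [mem_sigma, mem_filter, Fintype.mem_piFinset] at hτ
    rw [mem_filter, Fintype.mem_piFinset, List.ofFn_cons, List.prod_cons, ← mul_assoc]
    exact ⟨fun i => Fin.cases hτ.1 hτ.2.1 i, hτ.2.2⟩
  · intro τ _
    exact Fin.cons_self_tail τ
  · rintro ⟨t, τ⟩ _
    rfl

theorem two_mul_countJoining_succ (m : ℕ) (σ : Perm α) :
    2 * countJoining (m + 1) σ =
      ∑ p ∈ (univ : Finset α).offDiag, countJoining m (σ * swap p.1 p.2) := by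
  rw [countJoining_succ, sum_swap_offDiag fun t => countJoining m (σ * t)]

theorem countJoining_eq_zero {m : ℕ} {σ : Perm α} (h : m + 1 < #(cycleClasses σ)) :
    countJoining m σ = 0 := by
  induction m generalizing σ with
  | zero => rw [countJoining_zero, if_neg (by lia)]
  | succ m ih =>
    rw [countJoining_succ]
    refine sum_eq_zero fun t ht => ih ?_
    obtain ⟨x, y, -, rfl⟩ := mem_transpositions.1 ht
    by_cases hxy : σ.SameCycle x y
    · have := card_cycleClasses_le_mul_swap hxy
      lia
    · have := card_cycleClasses_mul_swap hxy
      lia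

theorem cycleLengthProd_of_card_eq_one {σ : Perm α} (h : #(cycleClasses σ) = 1) :
    cycleLengthProd σ = Fintype.card α := by
  obtain ⟨s, hs⟩ := card_eq_one.1 h
  rw [cycleLengthProd, hs, prod_singleton, ← card_univ]
  congr 1
  ext x
  have hx := cycleClass_mem_cycleClasses σ x
  rw [hs, mem_singleton] at hx
  simp [← hx, mem_cycleClass, SameCycle.refl]

theorem countJoining_mul_card {m : ℕ} {σ : Perm α} (h : #(cycleClasses σ) = m + 1) :
    countJoining m σ * Fintype.card α =
      cycleLengthProd σ * Fintype.card α ^ m * m.factorial := by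
  induction m generalizing σ with
  | zero => simp [countJoining_zero, h, cycleLengthProd_of_card_eq_one h]
  | succ m ih =>
    have hsum : 2 * countJoining (m + 1) σ = ∑ p : α × α with ¬ σ.SameCycle p.1 p.2,
        countJoining m (σ * swap p.1 p.2) := by
      rw [two_mul_countJoining_succ]
      symm
      refine sum_subset ?_ ?_
      · rintro ⟨x, y⟩ hp
        simp only [mem_filter, mem_univ, true_and] at hp
        simp only [mem_offDiag, mem_univ, true_and]
        rintro rfl
        exact hp (SameCycle.refl σ x)
      · rintro ⟨x, y⟩ - hp
        simp only [mem_filter, mem_univ, true_and, not_not] at hp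
        have := card_cycleClasses_le_mul_swap hp
        exact countJoining_eq_zero (by simp only; lia)
    have hjoin : ∀ p ∈ ({p | ¬ σ.SameCycle p.1 p.2} : Finset (α × α)),
        (countJoining m (σ * swap p.1 p.2) * Fintype.card α : ℚ) =
          cycleLengthProd (σ * swap p.1 p.2) * (Fintype.card α ^ m * m.factorial) := by
      intro p hp
      have := card_cycleClasses_mul_swap (mem_filter.1 hp).2
      rw [← mul_assoc]
      exact_mod_cast ih (by lia)
    have hcount : (2 * countJoining (m + 1) σ * Fintype.card α : ℚ) =
        2 * (cycleLengthProd σ * Fintype.card α ^ (m + 1) * (m + 1).factorial) := by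
      have : (2 * countJoining (m + 1) σ : ℚ) = ∑ p : α × α with ¬ σ.SameCycle p.1 p.2,
          (countJoining m (σ * swap p.1 p.2) : ℚ) := by exact_mod_cast hsum
      rw [this, sum_mul, sum_congr rfl hjoin, ← sum_mul, sum_cycleLengthProd_mul_swap, h,
        Nat.factorial_succ]
      push_cast
      ring
    rw [mul_assoc] at hcount
    exact_mod_cast mul_left_cancel₀ two_ne_zero hcount

theorem cycleClasses_one : cycleClasses (1 : Perm α) = univ.image fun x => {x} := by
  refine image_congr fun x _ => ?_
  ext y
  simp [mem_cycleClass, eq_comm]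

theorem card_cycleClasses_one : #(cycleClasses (1 : Perm α)) = Fintype.card α := by
  rw [cycleClasses_one, card_image_of_injective _ singleton_injective, card_univ]

theorem cycleLengthProd_one : cycleLengthProd (1 : Perm α) = 1 := by
  rw [cycleLengthProd, cycleClasses_one]
  refine prod_eq_one fun s hs => ?_
  obtain ⟨x, -, rfl⟩ := mem_image.1 hs
  exact card_singleton x

theorem card_cycleClasses_eq_one_iff (hα : 2 ≤ Fintype.card α) {σ : Perm α} :
    #(cycleClasses σ) = 1 ↔ σ.cycleType = {Fintype.card α} := by
  have : Nontrivial α := Fintype.one_lt_card_iff_nontrivial.1 hα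
  constructor
  · intro h
    have hall : ∀ x y, σ.SameCycle x y := fun x y => cycleClass_eq_iff.1
      (card_le_one.1 h.le _ (cycleClass_mem_cycleClasses σ x) _ (cycleClass_mem_cycleClasses σ y))
    have hmove : ∀ x, σ x ≠ x := by
      intro x hx
      obtain ⟨y, hy⟩ := exists_ne x
      exact hy ((hall x y).eq_of_left hx).symm
    obtain ⟨x⟩ : Nonempty α := inferInstance
    have hcyc : σ.IsCycle := ⟨x, hmove x, fun y _ => hall x y⟩
    have hsupp : σ.support = univ := by ext; simp [hmove]
    rw [hcyc.cycleType, hsupp, card_univ]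
  · intro h
    have hcyc : σ.IsCycle := card_cycleType_eq_one.1 (by rw [h, Multiset.card_singleton])
    have hsupp : σ.support = univ := by
      rw [← card_eq_iff_eq_univ, ← sum_cycleType, h, Multiset.sum_singleton]
    have hmove : ∀ x, σ x ≠ x := fun x => mem_support.1 (hsupp ▸ mem_univ x)
    obtain ⟨x⟩ : Nonempty α := inferInstance
    refine card_eq_one.2 ⟨cycleClass σ x, ?_⟩
    refine eq_singleton_iff_unique_mem.2 ⟨cycleClass_mem_cycleClasses σ x, fun s hs => ?_⟩
    obtain ⟨y, -, rfl⟩ := mem_image.1 hs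
    exact cycleClass_eq_iff.2 (hcyc.sameCycle (hmove y) (hmove x))

/-- The `m`-tuples of transpositions with product `σ`. -/
def transpositionFactorizations (m : ℕ) (σ : Perm α) : Finset (Fin m → Perm α) :=
  {τ ∈ Fintype.piFinset fun _ : Fin m => transpositions α | (List.ofFn τ).prod = σ}

theorem card_transpositionFactorizations_le_of_isConj (m : ℕ) {σ σ' : Perm α} (h : IsConj σ σ') :
    #(transpositionFactorizations m σ) ≤ #(transpositionFactorizations m σ') := by
  obtain ⟨g, rfl⟩ := isConj_iff.1 h
  refine card_le_card_of_injOn (fun τ i => MulAut.conj g (τ i)) ?_ ?_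
  · intro τ hτ
    simp only [transpositionFactorizations, coe_filter, Set.mem_ofPred_eq,
      Fintype.mem_piFinset, mem_transpositions] at hτ ⊢
    refine ⟨fun i => ?_, ?_⟩
    · obtain ⟨x, y, hxy, h⟩ := hτ.1 i
      refine ⟨g x, g y, g.injective.ne hxy, ?_⟩
      rw [h, MulAut.conj_apply, swap_apply_apply]
    · rw [← hτ.2, ← MulAut.conj_apply, map_list_prod, List.map_ofFn]
      rfl
  · intro τ _ τ' _ h
    funext i
    exact (MulAut.conj g).injective (congrFun h i)

theorem card_transpositionFactorizations_of_cycleType (hα : 2 ≤ Fintype.card α) {σ : Perm α}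
    (hσ : σ.cycleType = {Fintype.card α}) :
    #(transpositionFactorizations (Fintype.card α - 1) σ) =
      Fintype.card α ^ (Fintype.card α - 2) := by
  set n := Fintype.card α with hn
  have hconst : ∀ g ∈ ({g | g.cycleType = {n}} : Finset (Perm α)),
      #(transpositionFactorizations (n - 1) g) = #(transpositionFactorizations (n - 1) σ) := by
    intro g hg
    have hconj : IsConj g σ := isConj_iff_cycleType_eq.2 ((mem_filter.1 hg).2.trans hσ.symm)
    exact (card_transpositionFactorizations_le_of_isConj _ hconj).antisymm
      (card_transpositionFactorizations_le_of_isConj _ hconj.symm)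
  have htotal : countJoining (n - 1) (1 : Perm α) =
      (n - 1).factorial * #(transpositionFactorizations (n - 1) σ) := by
    have hcycles := card_of_cycleType_singleton hα hn.le
    rw [← hn, Nat.choose_self, mul_one] at hcycles
    rw [countJoining, card_eq_sum_card_fiberwise (f := fun τ => (List.ofFn τ).prod)
      (t := ({g | g.cycleType = {n}} : Finset (Perm α))), ← hcycles, ← smul_eq_mul, ← sum_const]
    · refine sum_congr rfl fun g hg => ?_
      rw [← hconst g hg, transpositionFactorizations, filter_filter]
      congr 1
      refine filter_congr fun τ _ => and_iff_right_of_imp ?_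
      rintro rfl
      rw [one_mul, card_cycleClasses_eq_one_iff hα]
      exact (mem_filter.1 hg).2
    · intro τ hτ
      have := (mem_filter.1 hτ).2
      rw [one_mul, card_cycleClasses_eq_one_iff hα] at this
      simpa using this
  have hmain := countJoining_mul_card (m := n - 1) (σ := (1 : Perm α))
    (by rw [card_cycleClasses_one]; lia)
  rw [← hn, htotal, cycleLengthProd_one, one_mul, mul_comm (n ^ (n - 1)), mul_assoc,
    show n - 1 = n - 2 + 1 by lia, pow_succ] at hmain
  have hpos : 0 < n := by lia
  rw [show n - 1 = n - 2 + 1 by lia]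
  exact Nat.eq_of_mul_eq_mul_right hpos
    (Nat.eq_of_mul_eq_mul_left (Nat.factorial_pos _) hmain)

end CycleClasses

/-- **Hurwitz number `H_{0,1}(d)` / Cayley count.**
Let `d ≥ 2` and let `c` be a `d`-cycle in the symmetric group `S_d` (a single cycle
through all `d` points).  The number of ordered `(d-1)`-tuples `(τ_1, …, τ_{d-1})` of
transpositions in `S_d` with `τ_1 · τ_2 ⋯ τ_{d-1} = c` equals `d^(d-2)`. -/
theorem hurwitz_H01_transposition_factorizations_of_cycle
    (d : ℕ) (hd : 2 ≤ d) (c : Equiv.Perm (Fin d))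
    (hc : c.IsCycle) (hsupp : c.support = Finset.univ) :
    Nat.card {τ : Fin (d - 1) → Equiv.Perm (Fin d) //
      (∀ i, (τ i).IsSwap) ∧ (List.ofFn τ).prod = c} = d ^ (d - 2) := by
  have hcard : Fintype.card (Fin d) = d := Fintype.card_fin d
  have htype : c.cycleType = {Fintype.card (Fin d)} := by
    rw [hc.cycleType, hsupp, Finset.card_univ]
  have h := card_transpositionFactorizations_of_cycleType (by rwa [hcard]) htype
  rw [hcard] at h
  rw [← h]
  refine Nat.subtype_card _ fun τ => ?_
  simp only [transpositionFactorizations, Finset.mem_filter, Fintype.mem_piFinset,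
    mem_transpositions]
end

section
/- Let μ_1, μ_2 ≥ 1 be integers, let d = μ_1 + μ_2, and let π be a fixed permutation in the symmetric group S_d having exactly two orbits on {1,…,d}, of sizes μ_1 and μ_2. Then the number of ordered d-tuples (τ_1, …, τ_d) of transpositions in S_d such that τ_1 · τ_2 ⋯ τ_d = π and such that the subgroup generated by {τ_1, …, τ_d} acts transitively on {1,…,d} equals (μ_1 + μ_2 − 1)! · μ_1^(μ_1+1) · μ_2^(μ_2+1) / (μ_1! · μ_2!). -/
namespace Hurwitz

open Finset Polynomial in
theorem sum_choose_mul_pow_mul_add_pow (N : ℕ) :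
    ∑ j ∈ range (N + 1), C (((N + 1).choose (j + 1) : ℚ) * (j + 1) ^ j) *
      (X + C ((N : ℚ) - j)) ^ (N - j) = C ((N : ℚ) + 1) * (X + C ((N : ℚ) + 1)) ^ N := by
  induction N with
  | zero => simp
  | succ M ih =>
    rw [← sub_eq_zero]
    set p := ∑ j ∈ range (M + 1 + 1), C (((M + 1 + 1).choose (j + 1) : ℚ) * (j + 1) ^ j) *
      (X + C (((M + 1 : ℕ) : ℚ) - j)) ^ (M + 1 - j) -
        C (((M + 1 : ℕ) : ℚ) + 1) * (X + C (((M + 1 : ℕ) : ℚ) + 1)) ^ (M + 1) with hp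
    have hd : derivative p = 0 := by
      have ih' := congrArg (fun q => C ((M : ℚ) + 2) * q.comp (X + C 1)) ih
      simp only [Polynomial.sum_comp, mul_comp, C_comp, pow_comp, add_comp, X_comp] at ih'
      rw [hp, derivative_sub, derivative_sum, sub_eq_zero, sum_range_succ]
      simp only [derivative_mul, derivative_C, zero_mul, zero_add, derivative_X_add_C_pow]
      rw [Nat.sub_self]
      simp only [CharP.cast_eq_zero, map_zero, zero_mul, mul_zero, add_zero]
      rw [mul_sum] at ih'
      convert ih' using 1
      · refine sum_congr rfl fun j hj => ?_
        have hj' : j ≤ M := by simpa [Nat.lt_succ_iff] using hj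
        have h1 : M + 1 - j - 1 = M - j := by omega
        have h2 : ((M + 1 + 1).choose (j + 1) : ℚ) * ((M : ℚ) + 1 - j) =
            (M + 2) * ((M + 1).choose (j + 1)) := by
          have := Nat.choose_mul_succ_eq (M + 1) (j + 1)
          have h3 : M + 1 + 1 - (j + 1) = M + 1 - j := by omega
          rw [h3] at this
          have := congrArg (Nat.cast (R := ℚ)) this
          push_cast [Nat.cast_sub (show j ≤ M + 1 by omega)] at this
          linarith
        rw [h1, Nat.cast_sub (by omega), add_assoc X (C 1), ← C_add]
        have h4 : (1 : ℚ) + (M - j) = ((M + 1 : ℕ) : ℚ) - j := by push_cast; ring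
        rw [h4, ← mul_assoc, ← mul_assoc, ← C_mul, ← C_mul]
        congr 2
        push_cast
        linear_combination (j + 1 : ℚ) ^ j * h2
      · rw [add_assoc X (C 1), ← C_add]
        have h4 : (1 : ℚ) + (M + 1) = ((M + 1 : ℕ) : ℚ) + 1 := by push_cast; ring
        rw [h4]
        simp only [Nat.add_sub_cancel]
        rw [← mul_assoc, ← mul_assoc, ← C_mul, ← C_mul]
        congr 2
        push_cast
        ring
    have h0 : p.eval (-((M : ℚ) + 2)) = 0 := by
      have := congrFun (fwdDiff_iter_pow_eq_zero_of_lt (R := ℚ) (show M + 1 < M + 2 by omega)) 0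
      rw [fwdDiff_iter_eq_sum_shift, sum_range_succ'] at this
      simp only [hp, eval_sub, eval_finsetSum, eval_mul, eval_C, eval_pow, eval_add, eval_X]
      have h5 : -((M : ℚ) + 2) + (((M + 1 : ℕ) : ℚ) + 1) = 0 := by push_cast; ring
      rw [h5]
      simp at this
      simp only [zero_pow (Nat.succ_ne_zero M), mul_zero, sub_zero]
      rw [← this]
      refine sum_congr rfl fun j hj => ?_
      have hj' : j ≤ M + 1 := by simpa [Nat.lt_succ_iff] using hj
      obtain ⟨i, hi⟩ := Nat.exists_eq_add_of_le hj'
      have h6 : -((M : ℚ) + 2) + (((M + 1 : ℕ) : ℚ) - j) = - (j + 1) := by push_cast; ring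
      have h7 : M + 1 - j = i := by omega
      have h8 : ((j : ℚ) + 1) ^ (M + 1) = (j + 1) ^ j * (j + 1) ^ i := by rw [hi, pow_add]
      rw [h6, h7, neg_pow, h8]
      ring
    have hc := Polynomial.derivative_eq_zero.mp hd
    rw [natDegree_eq_zero] at hc
    obtain ⟨c, hc⟩ := hc
    rw [← hc] at h0 ⊢
    simpa using h0

/-- Coefficients `nⁿ / n!`. -/
def endoCoeff (n : ℕ) : ℚ := (n : ℚ) ^ n / n.factorial

/-- Coefficients `nⁿ⁻¹ / n!` of the tree function (zero for `n = 0`). -/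
def treeCoeff (n : ℕ) : ℚ := endoCoeff n / n

open Finset in
theorem sum_treeCoeff_mul_endoCoeff {m : ℕ} (hm : m ≠ 0) :
    ∑ p ∈ antidiagonal m, treeCoeff p.1 * endoCoeff p.2 = endoCoeff m := by
  obtain ⟨N, rfl⟩ := Nat.exists_eq_succ_of_ne_zero hm
  have h := congrArg (Polynomial.eval 0) (sum_choose_mul_pow_mul_add_pow N)
  simp only [Polynomial.eval_finsetSum, Polynomial.eval_mul, Polynomial.eval_C,
    Polynomial.eval_pow, Polynomial.eval_add, Polynomial.eval_X, zero_add] at h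
  rw [Finset.Nat.sum_antidiagonal_eq_sum_range_succ_mk, sum_range_succ']
  have h0 : treeCoeff 0 = 0 := by simp [treeCoeff]
  rw [h0, zero_mul, add_zero]
  have hf : ((N + 1).factorial : ℚ) ≠ 0 := by positivity
  rw [endoCoeff, eq_div_iff hf, Nat.succ_eq_add_one, Nat.cast_add_one, pow_succ',
    ← h, sum_mul]
  refine sum_congr rfl fun j hj => ?_
  have hj' : j ≤ N := by simpa [Nat.lt_succ_iff] using hj
  have h3 : N + 1 - (j + 1) = N - j := by omega
  rw [treeCoeff, endoCoeff, endoCoeff, h3, Nat.cast_choose ℚ (show j + 1 ≤ N + 1 by omega), h3,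
    Nat.cast_sub hj']
  have : ((j : ℚ) + 1) ≠ 0 := by positivity
  field_simp
  push_cast
  ring

section PowerSeries
open PowerSeries Finset

theorem coeff_X_mul_derivative (f : ℚ⟦X⟧) (n : ℕ) :
    coeff n (X * d⁄dX ℚ f) = n * coeff n f := by
  cases n with
  | zero => simp
  | succ n => rw [coeff_succ_X_mul, coeff_derivative]; push_cast; ring

theorem eq_zero_of_wronskian {f g : ℚ⟦X⟧} (hg0 : coeff 0 g = 0) (hg1 : coeff 1 g ≠ 0)
    (hf0 : coeff 0 f = 0) (hf1 : coeff 1 f = 0)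
    (h : X * d⁄dX ℚ f * g = f * (X * d⁄dX ℚ g)) : f = 0 := by
  ext n
  rw [map_zero]
  induction n using Nat.strong_induction_on with
  | _ n ih =>
    by_cases hn0 : n = 0
    · rwa [hn0]
    by_cases hn1 : n = 1
    · rwa [hn1]
    have hc := congrArg (coeff (n + 1)) h
    rw [coeff_mul, coeff_mul, sum_eq_single (n, 1), sum_eq_single (n, 1)] at hc
    · simp only [coeff_X_mul_derivative] at hc
      have h2 : ((n : ℚ) - 1) * coeff 1 g ≠ 0 :=
        mul_ne_zero (sub_ne_zero.mpr (by exact_mod_cast hn1)) hg1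
      refine (mul_eq_zero.mp ?_).resolve_left h2
      push_cast at hc
      linear_combination hc
    all_goals first
      | (intro hp; simp at hp)
      | (rintro ⟨i, j⟩ hp hne
         rw [HasAntidiagonal.mem_antidiagonal] at hp
         simp only [coeff_X_mul_derivative]
         rcases lt_or_ge i n with hi | hi
         · simp [ih i hi]
         · have hj : j = 0 := by
             by_contra hj
             simp only at hp
             have : i = n ∧ j = 1 := by omega
             exact hne (by rw [this.1, this.2])
           simp [hj, hg0])

/-- The tree function `T(xz)` as a power series in `z`. -/
noncomputable def treeSeries (x : ℚ) : ℚ⟦X⟧ := rescale x (PowerSeries.mk treeCoeff)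

/-- The series `∑ nⁿ (xz)ⁿ / n!` as a power series in `z`. -/
noncomputable def endoSeries (x : ℚ) : ℚ⟦X⟧ := rescale x (PowerSeries.mk endoCoeff)

theorem endoCoeff_zero : endoCoeff 0 = 1 := by simp [endoCoeff]

theorem treeCoeff_zero : treeCoeff 0 = 0 := by simp [treeCoeff]

theorem treeCoeff_one : treeCoeff 1 = 1 := by simp [treeCoeff, endoCoeff]

theorem natCast_mul_treeCoeff {n : ℕ} (hn : n ≠ 0) : n * treeCoeff n = endoCoeff n := by
  rw [treeCoeff]; field_simp

theorem coeff_treeSeries (x : ℚ) (n : ℕ) : coeff n (treeSeries x) = x ^ n * treeCoeff n := by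
  simp [treeSeries, coeff_rescale]

theorem coeff_endoSeries (x : ℚ) (n : ℕ) : coeff n (endoSeries x) = x ^ n * endoCoeff n := by
  simp [endoSeries, coeff_rescale]

theorem one_sub_treeSeries_mul_endoSeries (x : ℚ) : (1 - treeSeries x) * endoSeries x = 1 := by
  have h : (1 - PowerSeries.mk treeCoeff) * PowerSeries.mk endoCoeff = 1 := by
    ext m
    rw [sub_mul, one_mul, map_sub, coeff_mul, coeff_one]
    simp only [coeff_mk]
    split_ifs with hm
    · simp [hm, endoCoeff_zero, treeCoeff_zero]
    · rw [sum_treeCoeff_mul_endoCoeff hm, sub_self]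
  simpa [treeSeries, endoSeries] using congrArg (rescale x) h

theorem X_mul_derivative_treeSeries (x : ℚ) :
    X * d⁄dX ℚ (treeSeries x) = endoSeries x - 1 := by
  ext n
  rw [coeff_X_mul_derivative, map_sub, coeff_one, treeSeries, endoSeries, coeff_rescale,
    coeff_rescale, coeff_mk, coeff_mk]
  split_ifs with hn
  · simp [hn, endoCoeff_zero]
  · rw [← natCast_mul_treeCoeff hn]; ring

theorem X_mul_derivative_endoSeries (x : ℚ) :
    X * d⁄dX ℚ (endoSeries x) = (endoSeries x - 1) * endoSeries x ^ 2 := by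
  have h := one_sub_treeSeries_mul_endoSeries x
  have h1 := congrArg (fun f => X * d⁄dX ℚ f) h
  have h2 := X_mul_derivative_treeSeries x
  simp only [Derivation.leibniz, map_sub, smul_eq_mul,
    derivative_one] at h1
  linear_combination (endoSeries x) * h1 + endoSeries x ^ 2 * h2 -
    (X * d⁄dX ℚ (endoSeries x)) * h

/-- Coefficients of the series `x ∂ₓ P` where `P` is the two-part generating series. -/
def annularCoeff (a n : ℕ) : ℚ :=
  if n = 0 then 0 else a * endoCoeff a * endoCoeff n / (a + n)

/-- The series `x ∂ₓ P` evaluated at `(xz, yz)`. -/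
noncomputable def annularSeries (x y : ℚ) : ℚ⟦X⟧ :=
  PowerSeries.mk fun d => ∑ p ∈ antidiagonal d, annularCoeff p.1 p.2 * (x ^ p.1 * y ^ p.2)

theorem X_mul_derivative_annularSeries (x y : ℚ) :
    X * d⁄dX ℚ (annularSeries x y) = X * d⁄dX ℚ (endoSeries x) * (endoSeries y - 1) := by
  ext d
  rw [coeff_X_mul_derivative, coeff_mul, annularSeries, coeff_mk, mul_sum]
  refine sum_congr rfl fun p hp => ?_
  rw [HasAntidiagonal.mem_antidiagonal] at hp
  simp only [coeff_X_mul_derivative, map_sub, coeff_one, endoSeries, coeff_rescale, coeff_mk,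
    annularCoeff, ← hp]
  split_ifs with h
  · simp [h, endoCoeff_zero]
  · have : (p.1 : ℚ) + p.2 ≠ 0 := by positivity
    push_cast
    field_simp
    ring

theorem annularSeries_add_swap (x y : ℚ) :
    annularSeries x y + annularSeries y x = (endoSeries x - 1) * (endoSeries y - 1) := by
  ext d
  rw [map_add, coeff_mul, annularSeries, annularSeries, coeff_mk, coeff_mk,
    ← Nat.sum_antidiagonal_swap (n := d) (f := fun p => annularCoeff p.1 p.2 * (y ^ p.1 * x ^ p.2)),
    ← sum_add_distrib]
  refine sum_congr rfl fun p hp => ?_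
  obtain ⟨a, n⟩ := p
  simp only [map_sub, coeff_one, endoSeries, coeff_rescale, coeff_mk, annularCoeff, Prod.fst_swap,
    Prod.snd_swap]
  split_ifs with h h' h'
  · simp [h, h', endoCoeff_zero]
  · simp [h, endoCoeff_zero]
  · simp [h', endoCoeff_zero]
  · have : (a : ℚ) + n ≠ 0 := by positivity
    have : (n : ℚ) + a ≠ 0 := by positivity
    field_simp
    ring

theorem sub_mul_annularSeries {x y : ℚ} (hxy : x ≠ y) :
    (treeSeries x - treeSeries y) * annularSeries x y =
      (endoSeries x - 1) * treeSeries y -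
        C (x - y)⁻¹ * (C y * treeSeries x - C x * treeSeries y) := by
  rw [← sub_eq_zero]
  have hx := one_sub_treeSeries_mul_endoSeries x
  have hy := one_sub_treeSeries_mul_endoSeries y
  have dx := X_mul_derivative_treeSeries x
  have dy := X_mul_derivative_treeSeries y
  have dX := X_mul_derivative_endoSeries x
  have dA := X_mul_derivative_annularSeries x y
  have hc : (C (x - y)⁻¹ : ℚ⟦X⟧) * (C x - C y) = 1 := by
    rw [← map_sub, ← map_mul, inv_mul_cancel₀ (sub_ne_zero.mpr hxy), map_one]
  apply eq_zero_of_wronskian (g := treeSeries x - treeSeries y)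
  · simp [coeff_treeSeries, treeCoeff_zero, -coeff_zero_eq_constantCoeff]
  · simpa [coeff_treeSeries, treeCoeff_one, sub_eq_zero] using hxy
  · simp [coeff_mul, coeff_treeSeries, treeCoeff_zero, -coeff_zero_eq_constantCoeff, coeff_C]
  · have h1 : HasAntidiagonal.antidiagonal 1 = {((0 : ℕ), (1 : ℕ)), (1, 0)} := rfl
    simp [coeff_mul, h1, coeff_treeSeries, coeff_endoSeries, treeCoeff_one, treeCoeff_zero,
      endoCoeff_zero, annularSeries, annularCoeff, coeff_C, coeff_one,
      -coeff_zero_eq_constantCoeff]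
    right
    ring
  · simp only [Derivation.leibniz, map_sub, smul_eq_mul, derivative_one, derivative_C]
    generalize treeSeries x = s at *
    generalize treeSeries y = t at *
    generalize endoSeries x = P at *
    generalize endoSeries y = Q at *
    generalize annularSeries x y = A at *
    generalize (C x : ℚ⟦X⟧) = cx at *
    generalize (C y : ℚ⟦X⟧) = cy at *
    generalize (C (x - y)⁻¹ : ℚ⟦X⟧) = k at *
    generalize d⁄dX ℚ s = ds at *
    generalize d⁄dX ℚ t = dt at *
    generalize d⁄dX ℚ P = dP at *
    generalize d⁄dX ℚ A = dA' at *
    rw [dX] at dA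
    have hs : P * s = P - 1 := by linear_combination - hx
    have ht : Q * t = Q - 1 := by linear_combination - hy
    have hst : P * Q * (s - t) = P - Q := by linear_combination Q * hs - P * ht
    linear_combination (s - t) ^ 2 * dA - (s - t) * (t * dX + (P - 1) * dy -
      k * (cy * dx - cx * dy)) + ((P - 1) * t - k * (cy * s - cx * t)) * (dx - dy) +
      (t * (P - Q) - (s - t) * (Q - 1)) * hc - ((s - t) ^ 2 * (P - 1) * P ^ 2 - (s - t) * P) * ht -
      P * t * hst + (s - t) * t * P * (P - 1) * hst
theorem annularSeries_functional_equation {x y : ℚ} (hxy : x ≠ y) :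
    C (x - y) * ((1 - treeSeries x) * annularSeries x y + (1 - treeSeries y) * annularSeries y x) =
      C y * treeSeries x - C x * treeSeries y := by
  have h1 := sub_mul_annularSeries hxy
  have h2 := annularSeries_add_swap x y
  have hy := one_sub_treeSeries_mul_endoSeries y
  have hc : (C (x - y) : ℚ⟦X⟧) * C (x - y)⁻¹ = 1 := by
    rw [← map_mul, mul_inv_cancel₀ (sub_ne_zero.mpr hxy), map_one]
  linear_combination C (x - y) * ((1 - treeSeries y) * h2 - h1 + (endoSeries x - 1) * hy) +
    (C y * treeSeries x - C x * treeSeries y) * hc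

theorem coeff_treeSeries_mul_annularSeries (x y : ℚ) (d : ℕ) :
    coeff d (treeSeries x * annularSeries x y) =
      ∑ p ∈ antidiagonal d, (∑ q ∈ antidiagonal p.1, treeCoeff q.1 * annularCoeff q.2 p.2) *
        (x ^ p.1 * y ^ p.2) := by
  simp only [coeff_mul, coeff_treeSeries, annularSeries, coeff_mk, sum_mul, mul_sum, sum_sigma']
  refine sum_nbij' (fun ⟨⟨b, _⟩, ⟨a, n⟩⟩ => ⟨(b + a, n), (b, a)⟩)
    (fun ⟨⟨_, n⟩, ⟨b, a⟩⟩ => ⟨(b, a + n), (a, n)⟩) ?_ ?_ ?_ ?_ ?_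
  · rintro ⟨⟨b, e⟩, ⟨a, n⟩⟩ h
    simp at h ⊢
    omega
  · rintro ⟨⟨b, e⟩, ⟨a, n⟩⟩ h
    simp at h ⊢
    omega
  · rintro ⟨⟨b, e⟩, ⟨a, n⟩⟩ h
    simp at h ⊢
    omega
  · rintro ⟨⟨b, e⟩, ⟨a, n⟩⟩ h
    simp at h ⊢
    omega
  · rintro ⟨⟨b, e⟩, ⟨a, n⟩⟩ h
    simp only
    ring

theorem sub_mul_sum_interior (x y : ℚ) (d : ℕ) :
    (x - y) * ∑ p ∈ antidiagonal d, treeCoeff d *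
        (1 - (if p.1 = 0 then 1 else 0) - (if p.2 = 0 then 1 else 0)) * (x ^ p.1 * y ^ p.2) =
      treeCoeff d * (y * x ^ d - x * y ^ d) := by
  have h1 : ∑ p ∈ antidiagonal d, (if p.1 = 0 then x ^ p.1 * y ^ p.2 else 0) = y ^ d := by
    rw [sum_eq_single (0, d)]
    · simp
    · rintro ⟨a, b⟩ hp hne
      rw [if_neg]
      rintro rfl
      simp at hp hne
      exact hne hp
    · simp
  have h2 : ∑ p ∈ antidiagonal d, (if p.2 = 0 then x ^ p.1 * y ^ p.2 else 0) = x ^ d := by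
    rw [sum_eq_single (d, 0)]
    · simp
    · rintro ⟨a, b⟩ hp hne
      rw [if_neg]
      rintro rfl
      simp at hp hne
      exact hne hp
    · simp
  have h3 : (x - y) * ∑ p ∈ antidiagonal d, x ^ p.1 * y ^ p.2 = x ^ (d + 1) - y ^ (d + 1) := by
    rw [Nat.sum_antidiagonal_eq_sum_range_succ_mk, ← (Commute.all x y).mul_geom_sum₂ (d + 1)]
    simp
  simp only [mul_assoc, sub_mul, ite_mul, one_mul, zero_mul, ← mul_sum, sum_sub_distrib, h1, h2]
  linear_combination treeCoeff d * h3

theorem eq_zero_of_sum_antidiagonal_eq_zero {f : ℕ → ℕ → ℚ} {d : ℕ}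
    (h : ∀ x : ℚ, x ≠ 1 → ∑ p ∈ antidiagonal d, f p.1 p.2 * x ^ p.1 = 0) {m n : ℕ}
    (hmn : m + n = d) : f m n = 0 := by
  set q : Polynomial ℚ := ∑ i ∈ range (d + 1), Polynomial.monomial i (f i (d - i)) with hq
  have hev : ∀ x : ℚ, x ≠ 1 → q.eval x = 0 := by
    intro x hx
    rw [hq, Polynomial.eval_finsetSum, ← h x hx, Nat.sum_antidiagonal_eq_sum_range_succ_mk]
    simp
  have hq0 : q = 0 := by
    have : (Polynomial.X - Polynomial.C 1) * q = 0 := by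
      refine Polynomial.funext fun x => ?_
      by_cases hx : x = 1
      · simp [hx]
      · simp [hev x hx]
    exact (mul_eq_zero.mp this).resolve_left (Polynomial.X_sub_C_ne_zero 1)
  have hc := congrArg (fun r => Polynomial.coeff r m) hq0
  simp only [hq, Polynomial.finsetSum_coeff, Polynomial.coeff_monomial, Polynomial.coeff_zero] at hc
  rw [sum_ite_eq' (range (d + 1)) m, if_pos (by simp; omega)] at hc
  rwa [show n = d - m by omega]

/-- The coefficient form of the genus-zero cut-and-join equation for two parts. -/
theorem endoCoeff_mul_endoCoeff {m n : ℕ} (hm : m ≠ 0) (hn : n ≠ 0) :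
    endoCoeff m * endoCoeff n = treeCoeff (m + n) +
      ∑ q ∈ antidiagonal m, treeCoeff q.1 * annularCoeff q.2 n +
      ∑ q ∈ antidiagonal n, treeCoeff q.1 * annularCoeff q.2 m := by
  have key := eq_zero_of_sum_antidiagonal_eq_zero (d := m + n) (m := m) (n := n) (f := fun a b =>
    annularCoeff a b + annularCoeff b a -
      ∑ q ∈ antidiagonal a, treeCoeff q.1 * annularCoeff q.2 b -
      ∑ q ∈ antidiagonal b, treeCoeff q.1 * annularCoeff q.2 a -
      treeCoeff (m + n) * (1 - (if a = 0 then 1 else 0) - (if b = 0 then 1 else 0))) ?_ rfl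
  · have h1 : annularCoeff m n + annularCoeff n m = endoCoeff m * endoCoeff n := by
      rw [annularCoeff, annularCoeff, if_neg hn, if_neg hm]
      have : (m : ℚ) + n ≠ 0 := by positivity
      have : (n : ℚ) + m ≠ 0 := by positivity
      field_simp
      ring
    simp only [if_neg hm, if_neg hn] at key
    linear_combination key - h1
  · intro x hx
    have h := congrArg (coeff (m + n)) (annularSeries_functional_equation hx)
    have hJ := sub_mul_sum_interior x 1 (m + n)
    simp only [map_sub, coeff_C_mul, map_add, sub_mul, one_mul, coeff_treeSeries,
      coeff_treeSeries_mul_annularSeries] at h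
    simp only [annularSeries, coeff_mk] at h
    rw [← Nat.sum_antidiagonal_swap (n := m + n)
        (f := fun p => annularCoeff p.1 p.2 * (1 ^ p.1 * x ^ p.2)),
      ← Nat.sum_antidiagonal_swap (n := m + n) (f := fun p =>
        (∑ q ∈ antidiagonal p.1, treeCoeff q.1 * annularCoeff q.2 p.2) * (1 ^ p.1 * x ^ p.2))] at h
    simp only [one_pow, mul_one, one_mul, Prod.fst_swap, Prod.snd_swap] at h hJ
    refine (mul_eq_zero.mp ?_).resolve_left (sub_ne_zero.mpr hx)
    simp only [add_mul _ _ (x ^ _), sub_mul _ _ (x ^ _), sum_sub_distrib, sum_add_distrib] at hJ ⊢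
    linear_combination h - hJ

end PowerSeries

section Factorizations
open Finset

variable {G : Type*} [Group G] [DecidableEq G]

/-- The `k`-tuples of elements of `X` with product `g`. -/
def factorizations (X : Finset G) (k : ℕ) (g : G) : Finset (Fin k → G) :=
  (Fintype.piFinset fun _ => X).filter fun w => (List.ofFn w).prod = g

/-- The number of factorizations of `g` into `k` factors from `X`. -/
def numFactorizations (X : Finset G) (k : ℕ) (g : G) : ℚ := #(factorizations X k g)

theorem mem_factorizations {X : Finset G} {k : ℕ} {g : G} {w : Fin k → G} :
    w ∈ factorizations X k g ↔ (∀ i, w i ∈ X) ∧ (List.ofFn w).prod = g := by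
  simp [factorizations]

theorem factorizations_mono {X Y : Finset G} (h : X ⊆ Y) (k : ℕ) (g : G) :
    factorizations X k g ⊆ factorizations Y k g := fun w hw => by
  rw [mem_factorizations] at hw ⊢
  exact ⟨fun i => h (hw.1 i), hw.2⟩

theorem numFactorizations_zero (X : Finset G) (g : G) :
    numFactorizations X 0 g = if g = 1 then 1 else 0 := by
  rw [numFactorizations, factorizations]
  split_ifs with h
  · simp [h]
  · simp [Ne.symm h]

theorem numFactorizations_succ (X : Finset G) (k : ℕ) (g : G) :
    numFactorizations X (k + 1) g = ∑ t ∈ X, numFactorizations X k (g * t⁻¹) := by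
  simp only [numFactorizations]
  norm_cast
  rw [card_eq_sum_card_fiberwise (f := fun w => w (Fin.last k)) (t := X)
    (fun w hw => (mem_factorizations.mp hw).1 _)]
  refine sum_congr rfl fun t ht => ?_
  refine card_nbij' (fun w => Fin.init w) (fun w => Fin.snoc (α := fun _ => G) w t) ?_ ?_ ?_ ?_
  · intro w hw
    simp only [coe_filter, Set.mem_ofPred_eq, mem_factorizations, mem_coe] at hw ⊢
    obtain ⟨⟨h1, h2⟩, h3⟩ := hw
    refine ⟨fun i => h1 _, ?_⟩
    rw [List.ofFn_succ', List.concat_eq_append, List.prod_append, h3] at h2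
    rw [eq_mul_inv_iff_mul_eq]
    simpa [Fin.init_def] using h2
  · intro w hw
    simp only [coe_filter, Set.mem_ofPred_eq, mem_factorizations, mem_coe] at hw ⊢
    refine ⟨⟨fun i => ?_, ?_⟩, by simp⟩
    · refine Fin.lastCases ?_ (fun i => ?_) i
      · simpa using ht
      · simpa using hw.1 i
    · rw [List.ofFn_succ', List.concat_eq_append, List.prod_append]
      simp [hw.2]
  · intro w hw
    simp only [coe_filter, Set.mem_ofPred_eq] at hw
    rw [← hw.2]
    exact Fin.snoc_init_self w
  · intro w hw
    exact Fin.init_snoc _ _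

/-- Factorizations in a product of two commuting subgroups are shuffles. -/
theorem numFactorizations_union {P Q : Subgroup G} (hPQ : Disjoint P Q)
    (hcomm : ∀ p ∈ P, ∀ q ∈ Q, Commute p q) {X Y : Finset G} (hXY : Disjoint X Y)
    (hX : ∀ t ∈ X, t ∈ P) (hY : ∀ t ∈ Y, t ∈ Q) (k : ℕ) {g h : G} (hg : g ∈ P) (hh : h ∈ Q) :
    numFactorizations (X ∪ Y) k (g * h) = ∑ p ∈ antidiagonal k,
      (k.choose p.1 : ℚ) * (numFactorizations X p.1 g * numFactorizations Y p.2 h) := by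
  induction k generalizing g h with
  | zero =>
    have : g * h = 1 ↔ g = 1 ∧ h = 1 := by
      refine ⟨fun hgh => ?_, fun hgh => by simp [hgh]⟩
      have hgQ : g ∈ Q := by
        rw [mul_eq_one_iff_eq_inv.mp hgh]
        exact Q.inv_mem hh
      have hg1 : g = 1 := Subgroup.disjoint_def.mp hPQ hg hgQ
      exact ⟨hg1, by simpa [hg1] using hgh⟩
    simp only [numFactorizations_zero, this, Nat.antidiagonal_zero, sum_singleton, Nat.choose_self]
    by_cases h1 : g = 1 <;> by_cases h2 : h = 1 <;> simp [h1, h2]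
  | succ k ih =>
    rw [numFactorizations_succ, sum_union hXY,
      Finset.sum_antidiagonal_choose_succ_mul
        (fun i j => numFactorizations X i g * numFactorizations Y j h), add_comm]
    congr 1
    · simp only [numFactorizations_succ Y, mul_sum]
      rw [sum_comm]
      refine sum_congr rfl fun t ht => ?_
      rw [mul_assoc, ih hg (Q.mul_mem hh (Q.inv_mem (hY t ht)))]
    · simp only [numFactorizations_succ X, sum_mul, mul_sum]
      rw [sum_comm]
      refine sum_congr rfl fun t ht => ?_
      have hc : g * h * t⁻¹ = g * t⁻¹ * h := by
        rw [mul_assoc, mul_assoc, (hcomm t⁻¹ (P.inv_mem (hX t ht)) h hh).eq]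
      rw [hc, ih (P.mul_mem hg (P.inv_mem (hX t ht))) hh]
      refine sum_congr rfl fun p hp => ?_
      rw [HasAntidiagonal.mem_antidiagonal] at hp
      rw [Nat.choose_symm_of_eq_add hp.symm]

theorem sum_choose_eq_of_vanish {u v : ℕ → ℚ} {p q : ℕ} (hu : ∀ i < p, u i = 0)
    (hv : ∀ j < q, v j = 0) :
    ∑ r ∈ antidiagonal (p + q), ((p + q).choose r.1 : ℚ) * (u r.1 * v r.2) =
      ((p + q).choose p : ℚ) * (u p * v q) := by
  rw [sum_eq_single (p, q)]
  · rintro ⟨i, j⟩ hr hne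
    rw [HasAntidiagonal.mem_antidiagonal] at hr
    simp only at hr ⊢
    rcases lt_or_ge i p with hi | hi
    · simp [hu i hi]
    · have hj : j < q := by
        by_contra hj
        exact hne (by rw [Prod.mk.injEq]; omega)
      simp [hv j hj]
  · simp

end Factorizations

section Cycles
open Finset Equiv

theorem card_image_le_of_refines {α β γ : Type*} [Fintype α] [DecidableEq β] [DecidableEq γ]
    {f : α → β} {g : α → γ} (h : ∀ a b, g a = g b → f a = f b) :
    #(univ.image f) ≤ #(univ.image g) := by
  refine card_le_card_of_forall_subsingleton (fun b c => ∃ a, f a = b ∧ g a = c) ?_ ?_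
  · simp
  · rintro c - _ ⟨-, a, rfl, ha⟩ _ ⟨-, b, rfl, hb⟩
    exact h a b (ha.trans hb.symm)

theorem card_image_lt_of_refines {α β γ : Type*} [Fintype α] [DecidableEq β] [DecidableEq γ]
    {f : α → β} {g : α → γ} (h : ∀ a b, g a = g b → f a = f b) {x y : α} (hf : f x = f y)
    (hg : g x ≠ g y) : #(univ.image f) < #(univ.image g) := by
  have h1 : #(univ.image f) ≤ #((univ.image g).erase (g x)) := by
    refine card_le_card_of_forall_subsingleton (fun b c => ∃ a, f a = b ∧ g a = c) ?_ ?_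
    · simp only [mem_image, mem_univ, true_and, forall_exists_index, forall_apply_eq_imp_iff,
        mem_erase]
      intro a
      by_cases hax : g a = g x
      · exact ⟨g y, ⟨hg.symm, y, rfl⟩, y, by rw [← hf, h a x hax], rfl⟩
      · exact ⟨g a, ⟨hax, a, rfl⟩, a, rfl, rfl⟩
    · rintro c - _ ⟨-, a, rfl, ha⟩ _ ⟨-, b, rfl, hb⟩
      exact h a b (ha.trans hb.symm)
  exact h1.trans_lt (card_erase_lt_of_mem (mem_image_of_mem g (mem_univ x)))

/-- The function obtained from `f` by replacing its value at `x` by its value at `y`. -/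
def mergeValues {α β : Type*} [DecidableEq β] (f : α → β) (x y a : α) : β :=
  if f a = f x then f y else f a

theorem card_image_le_mergeValues {α β : Type*} [Fintype α] [DecidableEq β] (f : α → β)
    (x y : α) : #(univ.image f) ≤ #(univ.image (mergeValues f x y)) + 1 := by
  refine (card_le_card (t := insert (f x) (univ.image (mergeValues f x y))) ?_).trans
    (card_insert_le _ _)
  intro b hb
  obtain ⟨a, -, rfl⟩ := mem_image.mp hb
  by_cases hax : f a = f x
  · simp [hax]
  · exact mem_insert_of_mem (mem_image.mpr ⟨a, mem_univ a, by simp [mergeValues, hax]⟩)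

variable {α : Type*}

theorem eq_of_sameCycle [Finite α] {β : Type*} {π : Perm α} {f : α → β} (h : ∀ a, f (π a) = f a)
    {a b : α} (hab : π.SameCycle a b) : f a = f b := by
  obtain ⟨n, rfl⟩ := hab.exists_nat_pow_eq
  clear hab
  induction n with
  | zero => simp
  | succ n ih => rw [pow_succ', Perm.mul_apply, h, ← ih]

theorem mul_swap_apply_of_ne [DecidableEq α] {π : Perm α} {x y a : α} (hx : a ≠ x) (hy : a ≠ y) :
    (π * swap x y) a = π a := by
  rw [Perm.mul_apply, swap_apply_of_ne_of_ne hx hy]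

theorem sameCycle_mul_swap [Finite α] [DecidableEq α] {π : Perm α} {x y : α}
    (h : ¬ π.SameCycle x y) : (π * swap x y).SameCycle x y := by
  have key : ∀ n : ℕ, (π * swap x y).SameCycle x ((π ^ (n + 1)) y) := by
    have h0 : (π * swap x y).SameCycle x (π y) := by
      refine ⟨1, by simp⟩
    intro n
    induction n with
    | zero => simpa using h0
    | succ n ih =>
      rw [pow_succ', Perm.mul_apply]
      set z := (π ^ (n + 1)) y with hz
      have hzx : z ≠ x := fun hzx => h (Perm.SameCycle.symm ⟨(n + 1 : ℕ), by
        rw [zpow_natCast, ← hz, hzx]⟩)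
      by_cases hzy : z = y
      · rw [hzy]; exact h0
      · rw [← mul_swap_apply_of_ne hzx hzy]
        exact Perm.sameCycle_apply_right.mpr ih
  have := key (orderOf π - 1)
  rwa [Nat.sub_add_cancel (orderOf_pos π), pow_orderOf_eq_one, Perm.one_apply] at this

theorem sameCycle_mul_swap_of_sameCycle [Finite α] [DecidableEq α] {π : Perm α} {x y : α}
    (h : ¬ π.SameCycle x y) {a b : α} (hab : π.SameCycle a b) :
    (π * swap x y).SameCycle a b := by
  have hxy := sameCycle_mul_swap h
  have key : ∀ c, (π * swap x y).SameCycle a (π c) = (π * swap x y).SameCycle a c := by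
    intro c
    rw [eq_iff_iff]
    have hr (u v : α) := @Perm.sameCycle_apply_right _ (π * swap x y) u v
    by_cases hcx : c = x
    · subst hcx
      have : π c = (π * swap c y) y := by simp
      rw [this, hr]
      exact ⟨fun h => h.trans hxy.symm, fun h => h.trans hxy⟩
    · by_cases hcy : c = y
      · subst hcy
        have : π c = (π * swap x c) x := by simp
        rw [this, hr]
        exact ⟨fun h => h.trans hxy, fun h => h.trans hxy.symm⟩
      · rw [← mul_swap_apply_of_ne hcx hcy, hr]
  rw [← eq_of_sameCycle key hab]

theorem apply_prod_of_forall {β : Type*} {f : α → β} {l : List (Perm α)}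
    (h : ∀ τ ∈ l, ∀ a, f (τ a) = f a) (a : α) : f (l.prod a) = f a := by
  induction l with
  | nil => simp
  | cons τ l ih =>
    rw [List.prod_cons, Perm.mul_apply, h τ (by simp), ih fun σ hσ => h σ (by simp [hσ])]

variable [Fintype α] [DecidableEq α]

/-- The set of points in the cycle of `a`. -/
noncomputable def cycleSet (π : Perm α) (a : α) : Finset α := by
  classical exact univ.filter fun b => π.SameCycle a b

theorem mem_cycleSet {π : Perm α} {a b : α} : b ∈ cycleSet π a ↔ π.SameCycle a b := by
  simp [cycleSet]

theorem cycleSet_eq_cycleSet {π : Perm α} {a b : α} :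
    cycleSet π a = cycleSet π b ↔ π.SameCycle a b := by
  refine ⟨fun h => ?_, fun h => ?_⟩
  · rw [← mem_cycleSet, h, mem_cycleSet]
  · ext c
    simp only [mem_cycleSet]
    exact ⟨h.symm.trans, h.trans⟩

/-- The number of cycles of a permutation, fixed points included. -/
noncomputable def numCycles (π : Perm α) : ℕ := #(univ.image (cycleSet π))

theorem numCycles_mul_swap_le (π : Perm α) (x y : α) :
    numCycles (π * swap x y) ≤ numCycles π + 1 := by
  refine (card_image_le_mergeValues _ x y).trans (Nat.add_le_add_right ?_ 1)
  refine card_image_le_of_refines fun a b hab => ?_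
  refine eq_of_sameCycle (fun c => ?_) (cycleSet_eq_cycleSet.mp hab)
  have hr (u : α) : cycleSet (π * swap x y) ((π * swap x y) u) = cycleSet (π * swap x y) u :=
    cycleSet_eq_cycleSet.mpr (Perm.sameCycle_apply_left.mpr (Perm.SameCycle.refl _ _))
  by_cases hcx : c = x
  · subst hcx
    have : π c = (π * swap c y) y := by simp
    rw [mergeValues, this, hr]
    simp [mergeValues]
  · by_cases hcy : c = y
    · subst hcy
      have : π c = (π * swap x c) x := by simp
      rw [mergeValues, this, hr]
      simp [mergeValues]
    · rw [mergeValues, ← mul_swap_apply_of_ne hcx hcy, hr, mergeValues]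

theorem numCycles_mul_swap_lt {π : Perm α} {x y : α} (h : ¬ π.SameCycle x y) :
    numCycles (π * swap x y) < numCycles π := by
  refine card_image_lt_of_refines (x := x) (y := y) (fun a b hab => ?_) ?_ ?_
  · rw [cycleSet_eq_cycleSet] at hab ⊢
    exact sameCycle_mul_swap_of_sameCycle h hab
  · exact cycleSet_eq_cycleSet.mpr (sameCycle_mul_swap h)
  · rwa [Ne, cycleSet_eq_cycleSet]

/-- The Riemann-Hurwitz inequality for products of transpositions. -/
theorem exists_invariant_card_add_numCycles_le (l : List (Perm α)) (hl : ∀ τ ∈ l, τ.IsSwap) :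
    ∃ f : α → α, (∀ τ ∈ l, ∀ a, f (τ a) = f a) ∧
      Fintype.card α + numCycles l.prod ≤ l.length + 2 * #(univ.image f) := by
  induction l using List.reverseRecOn with
  | nil =>
    refine ⟨id, by simp, ?_⟩
    have : numCycles (1 : Perm α) ≤ Fintype.card α := card_image_le
    simp only [List.prod_nil, List.length_nil, image_id, card_univ]
    omega
  | append_singleton l τ ih =>
    obtain ⟨f, hf, hcard⟩ := ih fun σ hσ => hl σ (by simp [hσ])
    obtain ⟨x, y, -, rfl⟩ := hl τ (by simp)
    simp only [List.prod_append, List.prod_singleton, List.length_append, List.length_singleton]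
    by_cases hxy : f x = f y
    · refine ⟨f, fun σ hσ a => ?_, ?_⟩
      · rcases List.mem_append.mp hσ with hσ | hσ
        · exact hf σ hσ a
        · rw [List.mem_singleton.mp hσ, swap_apply_def]
          split_ifs with h1 h2
          · rw [h1, hxy]
          · rw [h2, hxy]
          · rfl
      · have := numCycles_mul_swap_le l.prod x y
        omega
    · refine ⟨mergeValues f x y, fun σ hσ a => ?_, ?_⟩
      · rcases List.mem_append.mp hσ with hσ | hσ
        · simp [mergeValues, hf σ hσ a]
        · rw [List.mem_singleton.mp hσ, swap_apply_def]
          split_ifs with h1 h2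
          · simp [mergeValues, h1]
          · simp [mergeValues, h2]
          · rfl
      · have h1 := numCycles_mul_swap_lt (π := l.prod) (x := x) (y := y) fun h =>
          hxy (eq_of_sameCycle (apply_prod_of_forall hf) h)
        have h2 := card_image_le_mergeValues f x y
        omega

end Cycles

section Swaps
open Finset Equiv

variable {α : Type*}

/-- The permutations fixing every point outside of `S`. -/
def supportedOn (S : Finset α) : Subgroup (Perm α) := fixingSubgroup (Perm α) (S : Set α)ᶜ

theorem mem_supportedOn {S : Finset α} {g : Perm α} :
    g ∈ supportedOn S ↔ ∀ x ∉ S, g x = x := by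
  simp [supportedOn, mem_fixingSubgroup_iff]

theorem supportedOn_mono {S T : Finset α} (h : S ⊆ T) : supportedOn S ≤ supportedOn T :=
  fixingSubgroup_antitone _ _ (Set.compl_subset_compl.mpr (coe_subset.mpr h))

theorem supportedOn_apply_mem {S : Finset α} {g : Perm α} (hg : g ∈ supportedOn S) {x : α}
    (hx : x ∈ S) : g x ∈ S := by
  by_contra h
  exact h (by rwa [g.injective (mem_supportedOn.mp hg _ h)])

theorem commute_of_mem_supportedOn {A C : Finset α} (h : Disjoint A C) :
    ∀ p ∈ supportedOn A, ∀ q ∈ supportedOn C, Commute p q := fun p hp q hq =>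
  Perm.Disjoint.commute fun x => by
    by_cases hx : x ∈ A
    · exact Or.inr (mem_supportedOn.mp hq x (disjoint_left.mp h hx))
    · exact Or.inl (mem_supportedOn.mp hp x hx)

theorem disjoint_supportedOn {A C : Finset α} (h : Disjoint A C) :
    Disjoint (supportedOn A) (supportedOn C) := by
  refine Subgroup.disjoint_def.mpr fun {g} hA hC => Perm.ext fun x => ?_
  by_cases hx : x ∈ A
  · exact mem_supportedOn.mp hC x (disjoint_left.mp h hx)
  · exact mem_supportedOn.mp hA x hx

theorem swap_mem_supportedOn [DecidableEq α] {S : Finset α} {x y : α} (hx : x ∈ S) (hy : y ∈ S) :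
    swap x y ∈ supportedOn S := mem_supportedOn.mpr fun _ hz =>
  swap_apply_of_ne_of_ne (fun h => hz (h ▸ hx)) (fun h => hz (h ▸ hy))

variable [Fintype α] [DecidableEq α]

/-- The transpositions of two points of `S`. -/
def swaps (S : Finset α) : Finset (Perm α) := S.offDiag.image fun p => swap p.1 p.2

/-- The transpositions of a point of `A` and a point of `C`. -/
def crossSwaps (A C : Finset α) : Finset (Perm α) := (A ×ˢ C).image fun p => swap p.1 p.2

theorem mem_swaps {S : Finset α} {τ : Perm α} :
    τ ∈ swaps S ↔ ∃ x ∈ S, ∃ y ∈ S, x ≠ y ∧ τ = swap x y := by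
  simp only [swaps, mem_image, mem_offDiag, Prod.exists]
  constructor
  · rintro ⟨x, y, ⟨hx, hy, hxy⟩, rfl⟩
    exact ⟨x, hx, y, hy, hxy, rfl⟩
  · rintro ⟨x, hx, y, hy, hxy, rfl⟩
    exact ⟨x, y, ⟨hx, hy, hxy⟩, rfl⟩

theorem mem_crossSwaps {A C : Finset α} {τ : Perm α} :
    τ ∈ crossSwaps A C ↔ ∃ x ∈ A, ∃ y ∈ C, τ = swap x y := by
  simp only [crossSwaps, mem_image, mem_product, Prod.exists]
  constructor
  · rintro ⟨x, y, ⟨hx, hy⟩, rfl⟩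
    exact ⟨x, hx, y, hy, rfl⟩
  · rintro ⟨x, hx, y, hy, rfl⟩
    exact ⟨x, y, ⟨hx, hy⟩, rfl⟩

theorem swaps_mono {S T : Finset α} (h : S ⊆ T) : swaps S ⊆ swaps T := fun τ hτ => by
  obtain ⟨x, hx, y, hy, hxy, rfl⟩ := mem_swaps.mp hτ
  exact mem_swaps.mpr ⟨x, h hx, y, h hy, hxy, rfl⟩

theorem swaps_subset_supportedOn {S : Finset α} : ∀ τ ∈ swaps S, τ ∈ supportedOn S := by
  intro τ hτ
  obtain ⟨x, hx, y, hy, -, rfl⟩ := mem_swaps.mp hτ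
  exact swap_mem_supportedOn hx hy

theorem inv_eq_of_mem_swaps {S : Finset α} {τ : Perm α} (h : τ ∈ swaps S) : τ⁻¹ = τ := by
  obtain ⟨x, -, y, -, -, rfl⟩ := mem_swaps.mp h
  exact swap_inv x y

theorem isSwap_of_mem_swaps {S : Finset α} {τ : Perm α} (h : τ ∈ swaps S) : τ.IsSwap := by
  obtain ⟨x, -, y, -, hxy, rfl⟩ := mem_swaps.mp h
  exact ⟨x, y, hxy, rfl⟩

theorem disjoint_swaps {A C : Finset α} (h : Disjoint A C) : Disjoint (swaps A) (swaps C) := by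
  refine disjoint_left.mpr fun τ hA hC => ?_
  have := Subgroup.disjoint_def.mp (disjoint_supportedOn h) (swaps_subset_supportedOn τ hA)
    (swaps_subset_supportedOn τ hC)
  obtain ⟨x, y, hxy, rfl⟩ := isSwap_of_mem_swaps hA
  exact hxy (swap_eq_one_iff.mp this)

theorem swaps_union {A C : Finset α} (h : Disjoint A C) :
    swaps (A ∪ C) = swaps A ∪ swaps C ∪ crossSwaps A C := by
  refine Subset.antisymm (fun τ hτ => ?_) (union_subset (union_subset
    (swaps_mono subset_union_left) (swaps_mono subset_union_right)) fun τ hτ => ?_)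
  · obtain ⟨x, hx, y, hy, hxy, rfl⟩ := mem_swaps.mp hτ
    simp only [mem_union]
    rcases mem_union.mp hx with hx | hx <;> rcases mem_union.mp hy with hy | hy
    · exact Or.inl (Or.inl (mem_swaps.mpr ⟨x, hx, y, hy, hxy, rfl⟩))
    · exact Or.inr (mem_crossSwaps.mpr ⟨x, hx, y, hy, rfl⟩)
    · exact Or.inr (mem_crossSwaps.mpr ⟨y, hy, x, hx, swap_comm x y⟩)
    · exact Or.inl (Or.inr (mem_swaps.mpr ⟨x, hx, y, hy, hxy, rfl⟩))
  · obtain ⟨x, hx, y, hy, rfl⟩ := mem_crossSwaps.mp hτ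
    exact mem_swaps.mpr ⟨x, mem_union_left _ hx, y, mem_union_right _ hy,
      fun hxy => disjoint_left.mp h hx (hxy ▸ hy), rfl⟩

theorem disjoint_crossSwaps {A C : Finset α} (h : Disjoint A C) :
    Disjoint (swaps A ∪ swaps C) (crossSwaps A C) := by
  refine disjoint_right.mpr fun τ hτ hAC => ?_
  obtain ⟨x, hx, y, hy, rfl⟩ := mem_crossSwaps.mp hτ
  have hxy : x ≠ y := fun hxy => disjoint_left.mp h hx (hxy ▸ hy)
  rcases mem_union.mp hAC with hA | hC
  · have := mem_supportedOn.mp (swaps_subset_supportedOn _ hA) y (disjoint_right.mp h hy)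
    rw [swap_apply_right] at this
    exact hxy this
  · have := mem_supportedOn.mp (swaps_subset_supportedOn _ hC) x (disjoint_left.mp h hx)
    rw [swap_apply_left] at this
    exact hxy this.symm

theorem card_crossSwaps {A C : Finset α} (h : Disjoint A C) : #(crossSwaps A C) = #A * #C := by
  rw [crossSwaps, card_image_of_injOn, card_product]
  rintro ⟨x, y⟩ hp ⟨x', y'⟩ hp' heq
  simp only [coe_product, Set.mem_prod, mem_coe] at hp hp' heq
  have h1 : y = swap x' y' x := by rw [← heq, swap_apply_left]
  have h2 : x ≠ y' := fun h2 => disjoint_left.mp h hp.1 (h2 ▸ hp'.2)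
  by_cases h3 : x = x'
  · rw [h1, h3, swap_apply_left]
  · rw [swap_apply_of_ne_of_ne h3 h2] at h1
    exact absurd (h1 ▸ hp.2) (disjoint_left.mp h hp.1)

theorem two_mul_sum_swaps (S : Finset α) (φ : Perm α → ℚ) :
    2 * ∑ τ ∈ swaps S, φ τ = ∑ p ∈ S.offDiag, φ (swap p.1 p.2) := by
  rw [Finset.sum_comp φ (fun p : α × α => swap p.1 p.2), mul_sum]
  refine sum_congr rfl fun τ hτ => ?_
  obtain ⟨x, hx, y, hy, hxy, rfl⟩ := mem_swaps.mp hτ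
  have : {p ∈ S.offDiag | swap p.1 p.2 = swap x y} = {(x, y), (y, x)} := by
    ext ⟨a, b⟩
    simp only [mem_filter, mem_offDiag, mem_insert, mem_singleton, Prod.mk.injEq]
    constructor
    · rintro ⟨⟨ha, hb, hab⟩, heq⟩
      have h1 : b = swap x y a := by rw [← heq, swap_apply_left]
      by_cases hax : a = x
      · subst hax
        exact Or.inl ⟨rfl, by rw [h1, swap_apply_left]⟩
      · by_cases hay : a = y
        · subst hay
          exact Or.inr ⟨rfl, by rw [h1, swap_apply_right]⟩
        · rw [swap_apply_of_ne_of_ne hax hay] at h1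
          exact absurd h1.symm hab
    · rintro (⟨rfl, rfl⟩ | ⟨rfl, rfl⟩)
      · exact ⟨⟨hx, hy, hxy⟩, rfl⟩
      · exact ⟨⟨hy, hx, hxy.symm⟩, swap_comm _ _⟩
  rw [this, card_pair (by simp [hxy])]
  simp

/-- A product of transpositions of `S` which act transitively on `S` and whose product has at
least `#R` cycles on `S` has at least `#S + #R - 2` factors. -/
theorem card_add_card_le_length_add_two {S R : Finset α} {l : List (Perm α)}
    (hl : ∀ τ ∈ l, τ ∈ swaps S)
    (htrans : ∀ f : α → α, (∀ τ ∈ l, ∀ a, f (τ a) = f a) → ∀ a ∈ S, ∀ b ∈ S, f a = f b)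
    (hRS : R ⊆ S) (hR : ∀ a ∈ R, ∀ b ∈ R, l.prod.SameCycle a b → a = b) :
    #S + #R ≤ l.length + 2 := by
  obtain ⟨f, hf, hcard⟩ := exists_invariant_card_add_numCycles_le l
    fun τ hτ => isSwap_of_mem_swaps (hl τ hτ)
  have hfix : ∀ a ∉ S, l.prod a = a := mem_supportedOn.mp
    (Subgroup.list_prod_mem _ fun τ hτ => swaps_subset_supportedOn τ (hl τ hτ))
  have hsame : ∀ a ∉ S, ∀ b, l.prod.SameCycle a b → a = b := fun a ha b hab => by
    obtain ⟨n, rfl⟩ := hab.exists_nat_pow_eq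
    exact (Function.IsFixedPt.perm_pow (hfix a ha) n).symm
  have h1 : #(univ.image f) ≤ #Sᶜ + 1 := by
    rcases S.eq_empty_or_nonempty with rfl | ⟨s, hs⟩
    · exact card_image_le.trans (by simp)
    · refine (card_le_card (t := insert (f s) (Sᶜ.image f)) ?_).trans
        ((card_insert_le _ _).trans (Nat.add_le_add_right card_image_le 1))
      intro b hb
      obtain ⟨a, -, rfl⟩ := mem_image.mp hb
      by_cases ha : a ∈ S
      · rw [htrans f hf a ha s hs]
        exact mem_insert_self _ _
      · exact mem_insert_of_mem (mem_image_of_mem f (mem_compl.mpr ha))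
  have h2 : #Sᶜ + #R ≤ numCycles l.prod := by
    rw [← card_union_of_disjoint (disjoint_compl_left.mono_right hRS), numCycles]
    refine card_le_card_of_injOn (cycleSet l.prod) (fun a _ => by simp) ?_
    intro a ha b hb hab
    rw [cycleSet_eq_cycleSet] at hab
    simp only [coe_union, coe_compl, Set.mem_union, Set.mem_compl_iff, mem_coe] at ha hb
    rcases ha with ha | ha
    · exact hsame a ha b hab
    · rcases hb with hb | hb
      · exact (hsame b hb a hab.symm).symm
      · exact hR a ha b hb hab
  have h3 := card_compl_add_card S
  omega

end Swaps

section CutJoin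
open Finset Equiv

variable {α : Type*}

theorem isCycleOn_of_mapsTo {π : Perm α} {S : Finset α} (h : ∀ x ∈ S, π x ∈ S)
    (hs : ∀ x ∈ S, ∀ y ∈ S, π.SameCycle x y) : π.IsCycleOn S :=
  ⟨⟨h, π.injective.injOn, surjOn_of_injOn_of_card_le _ h π.injective.injOn le_rfl⟩, hs⟩

theorem isCycleOn_congr {π ρ : Perm α} {S : Finset α} (h : ∀ x ∈ S, ρ x = π x)
    (hπ : π.IsCycleOn S) : ρ.IsCycleOn S := by
  refine isCycleOn_of_mapsTo (fun x hx => h x hx ▸ hπ.1.mapsTo hx) fun x hx y hy => ?_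
  obtain ⟨n, -, rfl⟩ := hπ.exists_pow_eq hx hy
  have key : ∀ n : ℕ, (ρ ^ n) x = (π ^ n) x ∧ (π ^ n) x ∈ S := by
    intro n
    induction n with
    | zero => simpa using hx
    | succ n ih =>
      rw [pow_succ', pow_succ', Perm.mul_apply, Perm.mul_apply, ih.1]
      exact ⟨h _ ih.2, hπ.1.mapsTo ih.2⟩
  exact ⟨n, by rw [zpow_natCast]; exact (key n).1⟩

theorem pow_apply_mem {π : Perm α} {S : Finset α} (hS : π.IsCycleOn S) {x : α} (hx : x ∈ S)
    (i : ℕ) : (π ^ i) x ∈ S := by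
  induction i with
  | zero => simpa
  | succ i ih => rw [pow_succ', Perm.mul_apply]; exact hS.1.mapsTo ih

theorem mem_iff_of_sameCycle [Finite α] {π : Perm α} {S : Finset α} (hπ : π.IsCycleOn S) {a b : α}
    (h : π.SameCycle a b) : a ∈ S ↔ b ∈ S :=
  iff_of_eq (eq_of_sameCycle (f := fun c => c ∈ S) (fun _ => propext hπ.apply_mem_iff) h)

theorem not_sameCycle [Finite α] {π : Perm α} {A C : Finset α} (hA : π.IsCycleOn A)
    (hAC : Disjoint A C) {x y : α} (hx : x ∈ A) (hy : y ∈ C) : ¬ π.SameCycle x y := fun h =>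
  disjoint_left.mp hAC ((mem_iff_of_sameCycle hA h).mp hx) hy

variable [DecidableEq α]

theorem isCycleOn_union_mul_swap [Finite α] {π : Perm α} {A C : Finset α} (hA : π.IsCycleOn A)
    (hC : π.IsCycleOn C) (hAC : Disjoint A C) {x y : α} (hx : x ∈ A) (hy : y ∈ C) :
    (π * swap x y).IsCycleOn (A ∪ C : Finset α) := by
  have hxy := not_sameCycle hA hAC hx hy
  have key : ∀ z ∈ A ∪ C, (π * swap x y).SameCycle x z := by
    intro z hz
    rcases mem_union.mp hz with hz | hz
    · exact sameCycle_mul_swap_of_sameCycle hxy (hA.2 hx hz)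
    · exact (sameCycle_mul_swap hxy).trans (sameCycle_mul_swap_of_sameCycle hxy (hC.2 hy hz))
  refine isCycleOn_of_mapsTo (fun z hz => ?_) fun a ha b hb => (key a ha).symm.trans (key b hb)
  have hz' := supportedOn_apply_mem
    (swap_mem_supportedOn (mem_union_left C hx) (mem_union_right A hy)) hz
  rw [Perm.mul_apply]
  rcases mem_union.mp hz' with hz' | hz'
  · exact mem_union_left _ (hA.1.mapsTo hz')
  · exact mem_union_right _ (hC.1.mapsTo hz')

theorem isCycleOn_image_pow_mul_swap {π : Perm α} {S : Finset α} (hS : π.IsCycleOn S) {x : α}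
    (hx : x ∈ S) {j : ℕ} (hj : j ≠ 0) (hjS : j < #S) :
    (π * swap x ((π ^ j) x)).IsCycleOn ((Ioc 0 j).image fun i => (π ^ i) x : Finset α) := by
  set y := (π ^ j) x with hy
  set σ := π * swap x y with hσ
  have hstep : ∀ i ∈ Ioo 0 j, σ ((π ^ i) x) = (π ^ (i + 1)) x := by
    intro i hi
    rw [mem_Ioo] at hi
    rw [mul_swap_apply_of_ne, pow_succ', Perm.mul_apply]
    · rw [Ne, hS.pow_apply_eq hx]
      exact fun h => absurd (Nat.le_of_dvd hi.1 h) (by omega)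
    · rw [hy, Ne, hS.pow_apply_eq_pow_apply hx]
      exact fun h => absurd (h.eq_of_lt_of_lt (by omega) hjS) hi.2.ne
  have hσy : σ y = (π ^ 1) x := by simp [hσ]
  have key : ∀ i, 0 < i → i ≤ j → σ.SameCycle y ((π ^ i) x) := by
    intro i hi
    induction i, hi using Nat.le_induction with
    | base =>
      intro _
      rw [← hσy]
      exact Perm.sameCycle_apply_right.mpr (Perm.SameCycle.refl _ _)
    | succ i hi ih =>
      intro hij
      rw [← hstep i (mem_Ioo.mpr ⟨hi, hij⟩)]
      exact Perm.sameCycle_apply_right.mpr (ih (by omega))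
  refine isCycleOn_of_mapsTo (fun z hz => ?_) fun a ha b hb => ?_
  · obtain ⟨i, hi, rfl⟩ := mem_image.mp hz
    rw [mem_Ioc] at hi
    rcases hi.2.lt_or_eq with hij | rfl
    · rw [hstep i (mem_Ioo.mpr ⟨hi.1, hij⟩)]
      exact mem_image_of_mem _ (mem_Ioc.mpr ⟨by omega, hij⟩)
    · rw [← hy, hσy]
      exact mem_image_of_mem _ (mem_Ioc.mpr ⟨by omega, by omega⟩)
  · obtain ⟨i, hi, rfl⟩ := mem_image.mp ha
    obtain ⟨k, hk, rfl⟩ := mem_image.mp hb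
    rw [mem_Ioc] at hi hk
    exact (key i hi.1 hi.2).symm.trans (key k hk.1 hk.2)

theorem exists_isCycleOn_mul_swap {π : Perm α} {S : Finset α} (hS : π.IsCycleOn S) {x : α}
    (hx : x ∈ S) {j : ℕ} (hj : j ≠ 0) (hjS : j < #S) :
    ∃ A B : Finset α, Disjoint A B ∧ A ∪ B = S ∧ #A = j ∧ #B = #S - j ∧
      (π * swap x ((π ^ j) x)).IsCycleOn A ∧ (π * swap x ((π ^ j) x)).IsCycleOn B := by
  have hpow : ∀ i, (π ^ i) x ∈ S := pow_apply_mem hS hx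
  have hinj : ∀ u ≤ #S, ∀ v ≤ #S, 0 < u → 0 < v → (π ^ u) x = (π ^ v) x → u = v := by
    intro u hu v hv hu0 hv0 h
    rw [hS.pow_apply_eq_pow_apply hx] at h
    have h' : u - 1 ≡ v - 1 [MOD #S] := by
      apply Nat.ModEq.add_right_cancel' 1
      rwa [Nat.sub_add_cancel hu0, Nat.sub_add_cancel hv0]
    have := h'.eq_of_lt_of_lt (by omega) (by omega)
    omega
  have hback : (π ^ (#S - j)) ((π ^ j) x) = x := by
    rw [← Perm.mul_apply, ← pow_add, Nat.sub_add_cancel hjS.le, hS.pow_card_apply hx]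
  have hA := isCycleOn_image_pow_mul_swap hS hx hj hjS
  have hB := isCycleOn_image_pow_mul_swap hS (hpow j) (j := #S - j) (by omega) (by omega)
  rw [hback, swap_comm] at hB
  have hcA : #((Ioc 0 j).image fun i => (π ^ i) x) = j := by
    rw [card_image_of_injOn, Nat.card_Ioc, Nat.sub_zero]
    intro u hu v hv h
    rw [mem_coe, mem_Ioc] at hu hv
    exact hinj u (by omega) v (by omega) hu.1 hv.1 h
  have hcB : #((Ioc 0 (#S - j)).image fun i => (π ^ i) ((π ^ j) x)) = #S - j := by
    rw [card_image_of_injOn, Nat.card_Ioc, Nat.sub_zero]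
    intro u hu v hv h
    rw [mem_coe, mem_Ioc] at hu hv
    simp only [← Perm.mul_apply, ← pow_add] at h
    have := hinj _ (by omega) _ (by omega) (by omega) (by omega) h
    omega
  have hdisj : Disjoint ((Ioc 0 j).image fun i => (π ^ i) x)
      ((Ioc 0 (#S - j)).image fun i => (π ^ i) ((π ^ j) x)) := by
    refine disjoint_left.mpr fun a ha hb => ?_
    obtain ⟨u, hu, rfl⟩ := mem_image.mp ha
    obtain ⟨v, hv, h⟩ := mem_image.mp hb
    rw [mem_Ioc] at hu hv
    simp only [← Perm.mul_apply, ← pow_add] at h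
    have := hinj _ (by omega) _ (by omega) (by omega) (by omega) h
    omega
  refine ⟨_, _, hdisj, ?_, hcA, hcB, hA, hB⟩
  refine eq_of_subset_of_card_le (union_subset ?_ ?_) ?_
  · exact image_subset_iff.mpr fun i _ => hpow i
  · refine image_subset_iff.mpr fun i _ => ?_
    rw [← Perm.mul_apply, ← pow_add]
    exact hpow _
  · rw [card_union_of_disjoint hdisj, hcA, hcB]
    omega

/-- Summing over all ways of cutting a cycle in two pieces. -/
theorem two_mul_sum_swaps_of_isCycleOn [Fintype α] {π : Perm α} {S : Finset α}
    (hS : π.IsCycleOn S) {φ : Perm α → ℚ} {ψ : ℕ → ℕ → ℚ} (hψ₁ : ∀ n, ψ 0 n = 0)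
    (hψ₂ : ∀ n, ψ n 0 = 0)
    (h : ∀ τ ∈ swaps S, ∀ A B : Finset α, Disjoint A B → A ∪ B = S → A.Nonempty → B.Nonempty →
      (π * τ).IsCycleOn A → (π * τ).IsCycleOn B → φ τ = ψ #A #B) :
    2 * ∑ τ ∈ swaps S, φ τ = #S * ∑ p ∈ antidiagonal #S, ψ p.1 p.2 := by
  have hoff : S.offDiag = {p ∈ S ×ˢ S | p.1 ≠ p.2} := by
    ext p
    simp [and_assoc]
  rw [two_mul_sum_swaps, hoff, sum_filter, sum_product, ← nsmul_eq_mul, ← sum_const]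
  refine sum_congr rfl fun x hx => ?_
  rw [Nat.sum_antidiagonal_eq_sum_range_succ (fun i j => ψ i j), sum_range_succ,
    Nat.sub_self, hψ₂, add_zero]
  symm
  refine sum_nbij (fun j => (π ^ j) x) ?_ ?_ ?_ ?_
  · exact fun j _ => pow_apply_mem hS hx j
  · intro u hu v hv huv
    simp only [coe_range, Set.mem_Iio] at hu hv
    exact ((hS.pow_apply_eq_pow_apply hx).mp huv).eq_of_lt_of_lt hu hv
  · intro y hy
    obtain ⟨n, hn, rfl⟩ := hS.exists_pow_eq hx hy
    exact ⟨n, by simpa using hn, rfl⟩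
  · intro j hj
    rw [mem_range] at hj
    rcases eq_or_ne j 0 with rfl | hj0
    · simp [hψ₁]
    · have hne : x ≠ (π ^ j) x := fun hne => by
        rw [eq_comm, hS.pow_apply_eq hx] at hne
        exact absurd (Nat.le_of_dvd (by omega) hne) (by omega)
      obtain ⟨A, B, hAB, hu, hcA, hcB, hA, hB⟩ := exists_isCycleOn_mul_swap hS hx hj0 hj
      rw [if_pos hne, h _ _ A B hAB hu _ _ hA hB, hcA, hcB]
      · exact mem_swaps.mpr ⟨x, hx, _, pow_apply_mem hS hx j, hne, rfl⟩
      · exact card_pos.mp (by omega)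
      · exact card_pos.mp (by omega)

end CutJoin

section Trees
open Finset Equiv

theorem natCast_mul_sum_treeCoeff_mul_treeCoeff {n : ℕ} (hn : n ≠ 0) :
    n * ∑ p ∈ antidiagonal n, treeCoeff p.1 * treeCoeff p.2 = 2 * (n - 1) * treeCoeff n := by
  have h1 : ∑ p ∈ antidiagonal n, treeCoeff p.1 * (p.2 * treeCoeff p.2) =
      (n - 1) * treeCoeff n := by
    have h2 : ∀ p ∈ antidiagonal n, treeCoeff p.1 * endoCoeff p.2 =
        treeCoeff p.1 * (p.2 * treeCoeff p.2) + if p = (n, 0) then treeCoeff n else 0 := by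
      rintro ⟨a, b⟩ hp
      rw [HasAntidiagonal.mem_antidiagonal] at hp
      rcases eq_or_ne b 0 with rfl | hb
      · obtain rfl : a = n := by simpa using hp
        simp [endoCoeff_zero]
      · simp [natCast_mul_treeCoeff hb, hb]
    have h3 := sum_treeCoeff_mul_endoCoeff hn
    rw [sum_congr rfl h2, sum_add_distrib, sum_ite_eq' _ (n, 0),
      if_pos (by simp), ← natCast_mul_treeCoeff hn] at h3
    linear_combination h3
  have h4 : ∑ p ∈ antidiagonal n, (p.1 * treeCoeff p.1) * treeCoeff p.2 =
      (n - 1) * treeCoeff n := by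
    rw [← h1, ← Nat.sum_antidiagonal_swap]
    exact sum_congr rfl fun p _ => by simp only [Prod.fst_swap, Prod.snd_swap]; ring
  have h5 : n * ∑ p ∈ antidiagonal n, treeCoeff p.1 * treeCoeff p.2 =
      ∑ p ∈ antidiagonal n, (p.1 * treeCoeff p.1) * treeCoeff p.2 +
        ∑ p ∈ antidiagonal n, treeCoeff p.1 * (p.2 * treeCoeff p.2) := by
    rw [mul_sum, ← sum_add_distrib]
    refine sum_congr rfl fun p hp => ?_
    rw [HasAntidiagonal.mem_antidiagonal] at hp
    rw [← hp]
    push_cast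
    ring
  rw [h5, h4, h1]
  ring

variable {α : Type*} [DecidableEq α]

theorem exists_mul_eq_of_mem_supportedOn {A B : Finset α} {ρ : Perm α} (hAB : Disjoint A B)
    (hρ : ρ ∈ supportedOn (A ∪ B)) (hA : ∀ x, ρ x ∈ A ↔ x ∈ A) :
    ∃ g ∈ supportedOn A, ∃ h ∈ supportedOn B, ρ = g * h ∧ (∀ x ∈ A, g x = ρ x) ∧
      ∀ x ∈ B, h x = ρ x := by
  set g : Perm α := Perm.ofSubtype (ρ.subtypePerm hA) with hg
  have hgA : ∀ x ∈ A, g x = ρ x := fun x hx => by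
    rw [hg, Perm.ofSubtype_apply_of_mem _ hx, Perm.subtypePerm_apply]
  have hgS : g ∈ supportedOn A := mem_supportedOn.mpr fun x hx =>
    Perm.ofSubtype_apply_of_not_mem _ hx
  have hh : ∀ x ∉ A, (g⁻¹ * ρ) x = ρ x := fun x hx =>
    mem_supportedOn.mp (inv_mem hgS) _ fun h => hx ((hA x).mp h)
  refine ⟨g, hgS, g⁻¹ * ρ, mem_supportedOn.mpr fun x hx => ?_, by simp, hgA, fun x hx =>
    hh x (disjoint_right.mp hAB hx)⟩
  by_cases hxA : x ∈ A
  · rw [Perm.mul_apply, ← hgA x hxA]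
    simp
  · rw [hh x hxA]
    exact mem_supportedOn.mp hρ x (by simp [hxA, hx])

theorem apply_mem_iff_of_mem_supportedOn {A B : Finset α} {ρ : Perm α} (hAB : Disjoint A B)
    (hρ : ρ ∈ supportedOn B) (x : α) : ρ x ∈ A ↔ x ∈ A := by
  by_cases hx : x ∈ B
  · exact iff_of_false (disjoint_right.mp hAB (supportedOn_apply_mem hρ hx))
      (disjoint_right.mp hAB hx)
  · rw [mem_supportedOn.mp hρ x hx]

variable [Fintype α]

theorem mem_union_swaps_of_length_lt {A B : Finset α} {l : List (Perm α)} (hAB : Disjoint A B)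
    (hl : ∀ τ ∈ l, τ ∈ swaps (A ∪ B)) (hA : l.prod.IsCycleOn A) (hB : l.prod.IsCycleOn B)
    (hlen : l.length < #A + #B) : ∀ τ ∈ l, τ ∈ swaps A ∪ swaps B := by
  intro τ hτ
  have hτ' := hl τ hτ
  rw [swaps_union hAB, mem_union] at hτ'
  refine hτ'.resolve_right fun hcross => ?_
  obtain ⟨x, hx, y, hy, rfl⟩ := mem_crossSwaps.mp hcross
  have hxy : x ≠ y := fun hxy => disjoint_left.mp hAB hx (hxy ▸ hy)
  have key := card_add_card_le_length_add_two (R := {x, y}) hl ?_ ?_ ?_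
  · rw [card_union_of_disjoint hAB, card_pair hxy] at key
    omega
  · intro f hf
    have hfx : ∀ a ∈ A ∪ B, f a = f x := fun a ha => by
      have hf' := apply_prod_of_forall hf
      rcases mem_union.mp ha with ha | ha
      · exact eq_of_sameCycle hf' (hA.2 ha hx)
      · rw [eq_of_sameCycle hf' (hB.2 ha hy), ← hf _ hτ y, swap_apply_right]
    exact fun a ha b hb => (hfx a ha).trans (hfx b hb).symm
  · simp [insert_subset_iff, hx, hy]
  · have hn := not_sameCycle hA hAB hx hy
    simp only [mem_insert, mem_singleton]
    rintro a (rfl | rfl) b (rfl | rfl) h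
    · rfl
    · exact absurd h hn
    · exact absurd h.symm hn
    · rfl

theorem numFactorizations_swaps_union {A B : Finset α} {ρ : Perm α} (hAB : Disjoint A B)
    (hA : ρ.IsCycleOn A) (hB : ρ.IsCycleOn B) {k : ℕ} (hk : k < #A + #B) :
    numFactorizations (swaps (A ∪ B)) k ρ = numFactorizations (swaps A ∪ swaps B) k ρ := by
  have : factorizations (swaps (A ∪ B)) k ρ = factorizations (swaps A ∪ swaps B) k ρ := by
    refine Subset.antisymm (fun w hw => ?_) (factorizations_mono
      (union_subset (swaps_mono subset_union_left) (swaps_mono subset_union_right)) k ρ)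
    rw [mem_factorizations] at hw ⊢
    refine ⟨fun i => ?_, hw.2⟩
    refine mem_union_swaps_of_length_lt (l := List.ofFn w) hAB ?_ (hw.2 ▸ hA) (hw.2 ▸ hB)
      (by simpa using hk) _ (List.mem_ofFn.mpr ⟨i, rfl⟩)
    intro τ hτ
    obtain ⟨i, rfl⟩ := List.mem_ofFn.mp hτ
    exact hw.1 i
  rw [numFactorizations, numFactorizations, this]

theorem numFactorizations_swaps_eq_zero {S : Finset α} {π : Perm α} (hS : π.IsCycleOn S) {k : ℕ}
    (hk : k + 1 < #S) : numFactorizations (swaps S) k π = 0 := by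
  rw [numFactorizations, Nat.cast_eq_zero, card_eq_zero, eq_empty_iff_forall_notMem]
  intro w hw
  rw [mem_factorizations] at hw
  obtain ⟨s, hs⟩ : S.Nonempty := card_pos.mp (by omega)
  have key := card_add_card_le_length_add_two (S := S) (R := {s}) (l := List.ofFn w) ?_ ?_ ?_ ?_
  · rw [card_singleton, List.length_ofFn] at key
    omega
  · intro τ hτ
    obtain ⟨i, rfl⟩ := List.mem_ofFn.mp hτ
    exact hw.1 i
  · intro f hf a ha b hb
    refine eq_of_sameCycle (π := π) ?_ (hS.2 ha hb)
    rw [← hw.2]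
    exact apply_prod_of_forall hf
  · simpa using hs
  · simp

/-- Dénes' theorem: the number of minimal transposition factorizations of a cycle. -/
theorem numFactorizations_swaps_of_isCycleOn {S : Finset α} {π : Perm α} (hne : S.Nonempty)
    (hπ : π ∈ supportedOn S) (hS : π.IsCycleOn S) :
    numFactorizations (swaps S) (#S - 1) π = (#S - 1).factorial * treeCoeff #S := by
  induction hn : #S using Nat.strong_induction_on generalizing S π with
  | _ n ih =>
    subst hn
    rcases Nat.lt_or_ge #S 2 with h1 | h2
    · have hcard : #S = 1 := le_antisymm (by omega) hne.card_pos
      obtain ⟨s, rfl⟩ := card_eq_one.mp hcard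
      have hπ1 : π = 1 := Perm.ext fun x => by
        by_cases hx : x = s
        · subst hx
          simpa using hS
        · exact mem_supportedOn.mp hπ x (by simpa using hx)
      simp [hπ1, numFactorizations_zero, treeCoeff_one]
    · obtain ⟨k, hk⟩ : ∃ k, #S = k + 2 := ⟨#S - 2, by omega⟩
      have hsplit := two_mul_sum_swaps_of_isCycleOn hS
        (φ := fun τ => numFactorizations (swaps S) k (π * τ))
        (ψ := fun a b => k.factorial * (treeCoeff a * treeCoeff b))
        (by simp [treeCoeff_zero]) (by simp [treeCoeff_zero]) ?_
      · rw [← mul_sum] at hsplit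
        have hsum := natCast_mul_sum_treeCoeff_mul_treeCoeff (n := #S) (by omega)
        have hN : numFactorizations (swaps S) (#S - 1) π =
            ∑ τ ∈ swaps S, numFactorizations (swaps S) k (π * τ) := by
          rw [hk, Nat.add_sub_assoc (by norm_num), numFactorizations_succ]
          exact sum_congr rfl fun τ hτ => by rw [inv_eq_of_mem_swaps hτ]
        have hfac : (#S - 1).factorial = (k + 1) * k.factorial := by
          rw [hk]; exact Nat.factorial_succ k
        rw [hN, hfac]
        have hkq : (#S : ℚ) = k + 2 := by rw [hk]; push_cast; ring
        rw [hkq] at hsum hsplit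
        push_cast
        linear_combination (1 / 2 : ℚ) * hsplit + (k.factorial / 2 : ℚ) * hsum
      · intro τ hτ A B hAB hu hneA hneB hA hB
        subst hu
        have hcard := card_union_of_disjoint hAB
        have hA0 := hneA.card_pos
        have hB0 := hneB.card_pos
        have hρ := mul_mem hπ (swaps_subset_supportedOn τ hτ)
        obtain ⟨g, hg, h, hh, hgh, hgA, hhB⟩ :=
          exists_mul_eq_of_mem_supportedOn hAB hρ fun x => hA.apply_mem_iff
        have hgc := isCycleOn_congr hgA hA
        have hhc := isCycleOn_congr hhB hB
        rw [numFactorizations_swaps_union hAB hA hB (by omega), hgh,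
          numFactorizations_union (disjoint_supportedOn hAB) (commute_of_mem_supportedOn hAB)
            (disjoint_swaps hAB) swaps_subset_supportedOn swaps_subset_supportedOn k hg hh]
        have hkAB : k = (#A - 1) + (#B - 1) := by omega
        rw [hkAB, sum_choose_eq_of_vanish
          (u := fun i => numFactorizations (swaps A) i g)
          (v := fun i => numFactorizations (swaps B) i h)
          (fun i hi => numFactorizations_swaps_eq_zero hgc (by omega))
          (fun i hi => numFactorizations_swaps_eq_zero hhc (by omega)),
          ih #A (by omega) hneA hg hgc rfl, ih #B (by omega) hneB hh hhc rfl,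
          ← Nat.add_choose_mul_factorial_mul_factorial, ← Nat.choose_symm_add]
        push_cast
        ring

end Trees

section ThreeCycles
open Finset Equiv

variable {α : Type*} [Fintype α] [DecidableEq α]

theorem crossSwaps_comm (A C : Finset α) : crossSwaps A C = crossSwaps C A := by
  ext τ
  simp only [mem_crossSwaps]
  constructor <;>
  · rintro ⟨x, hx, y, hy, rfl⟩
    exact ⟨y, hy, x, hx, swap_comm x y⟩

theorem crossSwaps_subset_swaps {A C : Finset α} (h : Disjoint A C) :
    crossSwaps A C ⊆ swaps (A ∪ C) := by
  rw [swaps_union h]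
  exact subset_union_right

theorem disjoint_swaps_crossSwaps {T A C : Finset α} (hT : Disjoint T C) (hA : Disjoint A C) :
    Disjoint (swaps T) (crossSwaps A C) := by
  refine disjoint_right.mpr fun τ hτ hτT => ?_
  obtain ⟨x, hx, y, hy, rfl⟩ := mem_crossSwaps.mp hτ
  have := mem_supportedOn.mp (swaps_subset_supportedOn _ hτT) y (disjoint_right.mp hT hy)
  rw [swap_apply_right] at this
  exact disjoint_left.mp hA hx (this ▸ hy)

theorem factorizations_inter {G : Type*} [Group G] [DecidableEq G] (X Y : Finset G) (k : ℕ)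
    (g : G) : factorizations (X ∩ Y) k g = factorizations X k g ∩ factorizations Y k g := by
  ext w
  simp only [mem_inter, mem_factorizations]
  grind

theorem apply_eq_of_mem_crossSwaps {β : Type*} {f : α → β} {A C : Finset α} {ρ τ : Perm α}
    (hf : ∀ x, f (ρ x) = f x) (hA : ρ.IsCycleOn A) (hC : ρ.IsCycleOn C) {a c : α}
    (ha : a ∈ A) (hc : c ∈ C) (hτ : τ ∈ crossSwaps A C) (hfτ : ∀ x, f (τ x) = f x) :
    f a = f c := by
  obtain ⟨x, hx, y, hy, rfl⟩ := mem_crossSwaps.mp hτ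
  rw [eq_of_sameCycle hf (hA.2 ha hx), eq_of_sameCycle hf (hC.2 hc hy), ← hfτ y,
    swap_apply_right]

theorem mem_crossSwaps_or {A B C : Finset α} (h : Disjoint (A ∪ B) C) {τ : Perm α}
    (hτ : τ ∈ swaps (A ∪ B ∪ C)) (hτ' : τ ∉ swaps (A ∪ B) ∪ swaps C) :
    τ ∈ crossSwaps A C ∨ τ ∈ crossSwaps B C := by
  rw [swaps_union h, mem_union] at hτ
  obtain ⟨x, hx, y, hy, rfl⟩ := mem_crossSwaps.mp (hτ.resolve_left hτ')
  exact (mem_union.mp hx).imp (fun hx => mem_crossSwaps.mpr ⟨x, hx, y, hy, rfl⟩)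
    fun hx => mem_crossSwaps.mpr ⟨x, hx, y, hy, rfl⟩

theorem exists_forall_mem_of_length_lt {A B C : Finset α} {l : List (Perm α)}
    (hAB : Disjoint A B) (hAC : Disjoint A C) (hBC : Disjoint B C)
    (hneA : A.Nonempty) (hneB : B.Nonempty) (hneC : C.Nonempty)
    (hl : ∀ τ ∈ l, τ ∈ swaps (A ∪ B ∪ C)) (hA : l.prod.IsCycleOn A) (hB : l.prod.IsCycleOn B)
    (hC : l.prod.IsCycleOn C) (hlen : l.length < #A + #B + #C) :
    (∀ τ ∈ l, τ ∈ swaps (A ∪ B) ∪ swaps C) ∨ (∀ τ ∈ l, τ ∈ swaps (A ∪ C) ∪ swaps B) ∨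
      ∀ τ ∈ l, τ ∈ swaps (B ∪ C) ∪ swaps A := by
  by_contra! hcon
  obtain ⟨⟨τ₁, hl₁, h₁⟩, ⟨τ₂, hl₂, h₂⟩, ⟨τ₃, hl₃, h₃⟩⟩ := hcon
  obtain ⟨a, ha⟩ := hneA
  obtain ⟨b, hb⟩ := hneB
  obtain ⟨c, hc⟩ := hneC
  have hS : #(A ∪ B ∪ C) = #A + #B + #C := by
    rw [card_union_of_disjoint (disjoint_union_left.mpr ⟨hAC, hBC⟩), card_union_of_disjoint hAB]
  have hab := not_sameCycle hA hAB ha hb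
  have hac := not_sameCycle hA hAC ha hc
  have hbc := not_sameCycle hB hBC hb hc
  have hab' : a ≠ b := fun h => disjoint_left.mp hAB ha (h ▸ hb)
  have hac' : a ≠ c := fun h => disjoint_left.mp hAC ha (h ▸ hc)
  have hbc' : b ≠ c := fun h => disjoint_left.mp hBC hb (h ▸ hc)
  have key := card_add_card_le_length_add_two (R := {a, b, c}) hl ?_ ?_ ?_
  · rw [hS, card_eq_three.mpr ⟨a, b, c, hab', hac', hbc', rfl⟩] at key
    omega
  · intro f hf
    have hfρ := apply_prod_of_forall hf
    have g₁ := (mem_crossSwaps_or (disjoint_union_left.mpr ⟨hAC, hBC⟩) (hl τ₁ hl₁) h₁).imp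
      (apply_eq_of_mem_crossSwaps hfρ hA hC ha hc · (hf τ₁ hl₁))
      (apply_eq_of_mem_crossSwaps hfρ hB hC hb hc · (hf τ₁ hl₁))
    have g₂ := (mem_crossSwaps_or (disjoint_union_left.mpr ⟨hAB, hBC.symm⟩)
      (union_right_comm A B C ▸ hl τ₂ hl₂) h₂).imp
      (apply_eq_of_mem_crossSwaps hfρ hA hB ha hb · (hf τ₂ hl₂))
      (apply_eq_of_mem_crossSwaps hfρ hC hB hc hb · (hf τ₂ hl₂))
    have g₃ := (mem_crossSwaps_or (disjoint_union_left.mpr ⟨hAB.symm, hAC.symm⟩)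
      ((union_assoc A B C).trans (union_comm A (B ∪ C)) ▸ hl τ₃ hl₃) h₃).imp
      (apply_eq_of_mem_crossSwaps hfρ hB hA hb ha · (hf τ₃ hl₃))
      (apply_eq_of_mem_crossSwaps hfρ hC hA hc ha · (hf τ₃ hl₃))
    have hcross : f a = f b ∧ f a = f c := by grind
    have hfx : ∀ x ∈ A ∪ B ∪ C, f x = f a := fun x hx => by
      simp only [mem_union] at hx
      rcases hx with (hx | hx) | hx
      · exact eq_of_sameCycle hfρ (hA.2 hx ha)
      · rw [eq_of_sameCycle hfρ (hB.2 hx hb), hcross.1]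
      · rw [eq_of_sameCycle hfρ (hC.2 hx hc), hcross.2]
    exact fun x hx y hy => (hfx x hx).trans (hfx y hy).symm
  · simp [insert_subset_iff, ha, hb, hc]
  · have := hab ∘ Perm.SameCycle.symm
    have := hac ∘ Perm.SameCycle.symm
    have := hbc ∘ Perm.SameCycle.symm
    simp only [mem_insert, mem_singleton]
    rintro x (rfl | rfl | rfl) y (rfl | rfl | rfl) h <;> first | rfl | contradiction

theorem numFactorizations_swaps_three {A B C : Finset α} {ρ : Perm α}
    (hAB : Disjoint A B) (hAC : Disjoint A C) (hBC : Disjoint B C)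
    (hneA : A.Nonempty) (hneB : B.Nonempty) (hneC : C.Nonempty)
    (hA : ρ.IsCycleOn A) (hB : ρ.IsCycleOn B) (hC : ρ.IsCycleOn C) {k : ℕ}
    (hk : k < #A + #B + #C) :
    numFactorizations (swaps (A ∪ B ∪ C)) k ρ - numFactorizations (swaps (A ∪ B) ∪ swaps C) k ρ =
      (numFactorizations (swaps (A ∪ C) ∪ swaps B) k ρ -
        numFactorizations (swaps A ∪ swaps C ∪ swaps B) k ρ) +
      (numFactorizations (swaps (B ∪ C) ∪ swaps A) k ρ -
        numFactorizations (swaps B ∪ swaps C ∪ swaps A) k ρ) := by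
  set Y := swaps (A ∪ B) ∪ swaps C with hY
  set P := swaps (A ∪ C) ∪ swaps B with hP
  set Q := swaps (B ∪ C) ∪ swaps A with hQ
  set Z := swaps A ∪ swaps C ∪ swaps B with hZ
  have hZ' : swaps B ∪ swaps C ∪ swaps A = Z := by
    ext τ
    simp only [hZ, mem_union]
    tauto
  have hd₁ : Disjoint (crossSwaps A B) (crossSwaps A C) :=
    (disjoint_swaps_crossSwaps (disjoint_union_left.mpr ⟨hAC, hBC⟩) hAC).mono_left
      (crossSwaps_subset_swaps hAB)
  have hd₂ : Disjoint (crossSwaps A B) (crossSwaps B C) :=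
    (disjoint_swaps_crossSwaps (disjoint_union_left.mpr ⟨hAC, hBC⟩) hBC).mono_left
      (crossSwaps_subset_swaps hAB)
  have hd₃ : Disjoint (crossSwaps A C) (crossSwaps B C) := by
    rw [crossSwaps_comm B C]
    exact (disjoint_swaps_crossSwaps (disjoint_union_left.mpr ⟨hAB, hBC.symm⟩) hBC.symm).mono_left
      (crossSwaps_subset_swaps hAC)
  have hYP : Y ∩ P = Z := by
    rw [hY, hP, swaps_union hAB, swaps_union hAC, hZ]
    ext τ
    have : τ ∈ crossSwaps A B → τ ∉ crossSwaps A C :=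
      fun h => disjoint_left.mp hd₁ h
    simp only [mem_union, mem_inter]
    grind
  have hYQ : Y ∩ Q = Z := by
    rw [hY, hQ, swaps_union hAB, swaps_union hBC, hZ]
    ext τ
    have : τ ∈ crossSwaps A B → τ ∉ crossSwaps B C :=
      fun h => disjoint_left.mp hd₂ h
    simp only [mem_union, mem_inter]
    grind
  have hPQ : P ∩ Q = Z := by
    rw [hP, hQ, swaps_union hAC, swaps_union hBC, hZ]
    ext τ
    have : τ ∈ crossSwaps A C → τ ∉ crossSwaps B C :=
      fun h => disjoint_left.mp hd₃ h
    simp only [mem_union, mem_inter]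
    grind
  have hX : factorizations (swaps (A ∪ B ∪ C)) k ρ =
      factorizations Y k ρ ∪ factorizations P k ρ ∪ factorizations Q k ρ := by
    refine Subset.antisymm (fun w hw => ?_) (union_subset (union_subset ?_ ?_) ?_)
    · simp only [mem_union, mem_factorizations] at hw ⊢
      have key := exists_forall_mem_of_length_lt (l := List.ofFn w) hAB hAC hBC hneA hneB hneC
        ?_ (hw.2 ▸ hA) (hw.2 ▸ hB) (hw.2 ▸ hC) (by simpa using hk)
      · simp only [List.forall_mem_ofFn_iff] at key
        have := hw.2
        tauto
      · simpa only [List.forall_mem_ofFn_iff] using hw.1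
    · exact factorizations_mono (union_subset (swaps_mono subset_union_left)
        (swaps_mono subset_union_right)) k ρ
    · exact factorizations_mono (union_subset (swaps_mono (by grind))
        (swaps_mono (by grind))) k ρ
    · exact factorizations_mono (union_subset (swaps_mono (by grind))
        (swaps_mono (by grind))) k ρ
  have h1 := card_union_add_card_inter (factorizations Y k ρ ∪ factorizations P k ρ)
    (factorizations Q k ρ)
  have h2 := card_union_add_card_inter (factorizations Y k ρ) (factorizations P k ρ)
  rw [union_inter_distrib_right, ← factorizations_inter, ← factorizations_inter, hYQ, hPQ,
    union_self, ← hX] at h1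
  rw [← factorizations_inter, hYP] at h2
  rw [hZ']
  simp only [numFactorizations]
  qify at h1 h2
  linear_combination h1 + h2

end ThreeCycles

section Annulus
open Finset Equiv

variable {α : Type*} [Fintype α] [DecidableEq α]

/-- The number of factorizations of `π` into `k` transpositions of `A ∪ C`, not all of which
preserve `A` and `C`. -/
def numAnnular (A C : Finset α) (k : ℕ) (π : Perm α) : ℚ :=
  numFactorizations (swaps (A ∪ C)) k π - numFactorizations (swaps A ∪ swaps C) k π

theorem numAnnular_comm (A C : Finset α) (k : ℕ) (π : Perm α) :
    numAnnular A C k π = numAnnular C A k π := by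
  rw [numAnnular, numAnnular, union_comm A, union_comm (swaps A)]

theorem numAnnular_eq_zero {A C : Finset α} {π : Perm α} (hAC : Disjoint A C)
    (hA : π.IsCycleOn A) (hC : π.IsCycleOn C) {k : ℕ} (hk : k < #A + #C) :
    numAnnular A C k π = 0 :=
  sub_eq_zero.mpr (numFactorizations_swaps_union hAC hA hC hk)

theorem numFactorizations_sub_eq_of_numAnnular {A B C : Finset α} {ρ : Perm α}
    (hAB : Disjoint A B) (hAC : Disjoint A C) (hBC : Disjoint B C)
    (hneB : B.Nonempty) (hneC : C.Nonempty) (hρ : ρ ∈ supportedOn (A ∪ C ∪ B))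
    (hA : ρ.IsCycleOn A) (hB : ρ.IsCycleOn B) (hC : ρ.IsCycleOn C) {k : ℕ}
    (hk : k + 1 = #A + #B + #C)
    (hM : ∀ g ∈ supportedOn (A ∪ C), g.IsCycleOn A → g.IsCycleOn C →
      numAnnular A C (#A + #C) g =
        (#A + #C - 1).factorial * (#A * #C * (endoCoeff #A * endoCoeff #C))) :
    numFactorizations (swaps (A ∪ C) ∪ swaps B) k ρ -
      numFactorizations (swaps A ∪ swaps C ∪ swaps B) k ρ =
      k.factorial * #C * (treeCoeff #B * annularCoeff #A #C) := by
  have hACB : Disjoint (A ∪ C) B := disjoint_union_left.mpr ⟨hAB, hBC.symm⟩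
  obtain ⟨g, hg, h, hh, rfl, hgA, hhB⟩ := exists_mul_eq_of_mem_supportedOn hACB hρ fun x => by
    rw [mem_union, mem_union, ← mem_coe, ← mem_coe, hA.apply_mem_iff, hC.apply_mem_iff, mem_coe,
      mem_coe]
  have hgcA := isCycleOn_congr (fun x hx => hgA x (mem_union_left _ hx)) hA
  have hgcC := isCycleOn_congr (fun x hx => hgA x (mem_union_right _ hx)) hC
  have hhc := isCycleOn_congr hhB hB
  have hsub : ∀ t ∈ swaps A ∪ swaps C, t ∈ supportedOn (A ∪ C) := fun t ht =>
    swaps_subset_supportedOn t (union_subset (swaps_mono subset_union_left)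
      (swaps_mono subset_union_right) ht)
  have hB0 := hneB.card_pos
  have hC0 := hneC.card_pos
  obtain ⟨b, hb⟩ : ∃ b, #B = b + 1 := ⟨#B - 1, by omega⟩
  obtain ⟨s, hs⟩ : ∃ s, #A + #C = s + 1 := ⟨#A + #C - 1, by omega⟩
  have hkb : k = (#A + #C) + b := by omega
  rw [numFactorizations_union (disjoint_supportedOn hACB) (commute_of_mem_supportedOn hACB)
      (disjoint_swaps hACB) swaps_subset_supportedOn swaps_subset_supportedOn k hg hh,
    numFactorizations_union (disjoint_supportedOn hACB) (commute_of_mem_supportedOn hACB)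
      (disjoint_union_left.mpr ⟨disjoint_swaps hAB, disjoint_swaps hBC.symm⟩)
      hsub swaps_subset_supportedOn k hg hh, ← sum_sub_distrib]
  simp only [← mul_sub, ← sub_mul, ← numAnnular.eq_1]
  have hB' := numFactorizations_swaps_of_isCycleOn hneB hh hhc
  rw [hb, Nat.add_sub_cancel] at hB'
  have hM' := hM g hg hgcA hgcC
  rw [hkb, sum_choose_eq_of_vanish (u := fun i => numAnnular A C i g)
    (v := fun i => numFactorizations (swaps B) i h)
    (fun i hi => numAnnular_eq_zero hAC hgcA hgcC hi)
    (fun i hi => numFactorizations_swaps_eq_zero hhc (by omega)), hB', hM',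
    ← Nat.add_choose_mul_factorial_mul_factorial, ← Nat.choose_symm_add, annularCoeff,
    if_neg hC0.ne', hb]
  have hsq : (#A : ℚ) + #C = s + 1 := by exact_mod_cast hs
  rw [hsq, hs, Nat.add_sub_cancel, Nat.factorial_succ]
  push_cast
  field_simp

theorem sum_swaps_numFactorizations_sub {A C : Finset α} {π : Perm α} (hAC : Disjoint A C)
    (hneC : C.Nonempty) (hπ : π ∈ supportedOn (A ∪ C)) (hA : π.IsCycleOn A) (hC : π.IsCycleOn C)
    {k : ℕ} (hk : k + 1 = #A + #C)
    (hM : ∀ B ⊂ A, B.Nonempty → ∀ g ∈ supportedOn (B ∪ C), g.IsCycleOn B → g.IsCycleOn C →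
      numAnnular B C (#B + #C) g =
        (#B + #C - 1).factorial * (#B * #C * (endoCoeff #B * endoCoeff #C))) :
    ∑ τ ∈ swaps A, numAnnular A C k (π * τ) = k.factorial * (#A * #C *
      ∑ p ∈ antidiagonal #A, treeCoeff p.1 * annularCoeff p.2 #C) := by
  have h := two_mul_sum_swaps_of_isCycleOn hA (φ := fun τ => numAnnular A C k (π * τ))
    (ψ := fun a b => k.factorial * #C * (treeCoeff b * annularCoeff a #C) +
      k.factorial * #C * (treeCoeff a * annularCoeff b #C))
    (by simp [treeCoeff_zero, annularCoeff]) (by simp [treeCoeff_zero, annularCoeff]) ?_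
  · have hswap : ∑ p ∈ antidiagonal #A, treeCoeff p.2 * annularCoeff p.1 #C =
        ∑ p ∈ antidiagonal #A, treeCoeff p.1 * annularCoeff p.2 #C := by
      rw [← Nat.sum_antidiagonal_swap]
      simp only [Prod.fst_swap, Prod.snd_swap]
    rw [sum_add_distrib, ← mul_sum, ← mul_sum, hswap] at h
    linear_combination (1 / 2 : ℚ) * h
  · intro τ hτ A₁ B hd hu hneA₁ hneB hcA hcB
    subst hu
    obtain ⟨hA₁C, hBC⟩ := disjoint_union_left.mp hAC
    have hcard := card_union_of_disjoint hd
    have hρ := mul_mem hπ (supportedOn_mono subset_union_left (swaps_subset_supportedOn τ hτ))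
    have hcC : (π * τ).IsCycleOn C := isCycleOn_congr (fun x hx => by
      rw [Perm.mul_apply, mem_supportedOn.mp (swaps_subset_supportedOn τ hτ) x
        (disjoint_right.mp hAC hx)]) hC
    rw [numAnnular, numFactorizations_swaps_three hd hA₁C hBC hneA₁ hneB hneC hcA hcB hcC
        (by omega),
      numFactorizations_sub_eq_of_numAnnular hd hA₁C hBC hneB hneC
        (union_right_comm A₁ B C ▸ hρ) hcA hcB hcC (by omega) ?_,
      numFactorizations_sub_eq_of_numAnnular hd.symm hBC hA₁C hneA₁ hneC
        ((union_assoc A₁ B C).trans (union_comm A₁ (B ∪ C)) ▸ hρ) hcB hcA hcC (by omega) ?_]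
    · refine hM B ?_ hneB
      refine Finset.ssubset_iff_subset_ne.mpr ⟨subset_union_right, fun h => ?_⟩
      have := hneA₁.card_pos
      have := congrArg card h
      omega
    · refine hM A₁ ?_ hneA₁
      refine Finset.ssubset_iff_subset_ne.mpr ⟨subset_union_left, fun h => ?_⟩
      have := hneB.card_pos
      have := congrArg card h
      omega

/-- The number of transposition factorizations of minimal length of a permutation with two cycles
which do not preserve these cycles. -/
theorem numAnnular_of_isCycleOn {A C : Finset α} {π : Perm α} (hAC : Disjoint A C)
    (hneA : A.Nonempty) (hneC : C.Nonempty) (hπ : π ∈ supportedOn (A ∪ C))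
    (hA : π.IsCycleOn A) (hC : π.IsCycleOn C) :
    numAnnular A C (#A + #C) π =
      (#A + #C - 1).factorial * (#A * #C * (endoCoeff #A * endoCoeff #C)) := by
  induction hn : #A + #C using Nat.strong_induction_on generalizing A C π with
  | _ n ih =>
    subst hn
    have hA0 := hneA.card_pos
    have hC0 := hneC.card_pos
    obtain ⟨k, hk⟩ : ∃ k, #A + #C = k + 1 := ⟨#A + #C - 1, by omega⟩
    have hcard := card_union_of_disjoint hAC
    have hcross : ∀ τ ∈ crossSwaps A C, numFactorizations (swaps (A ∪ C)) k (π * τ) =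
        k.factorial * treeCoeff (#A + #C) := by
      intro τ hτ
      have hρ := mul_mem hπ (swaps_subset_supportedOn τ (crossSwaps_subset_swaps hAC hτ))
      obtain ⟨x, hx, y, hy, rfl⟩ := mem_crossSwaps.mp hτ
      have := numFactorizations_swaps_of_isCycleOn (hneA.mono subset_union_left) hρ
        (isCycleOn_union_mul_swap hA hC hAC hx hy)
      rwa [hcard, hk, Nat.add_sub_cancel, ← hk] at this
    have hsumA := sum_swaps_numFactorizations_sub hAC hneC hπ hA hC hk.symm
      fun B hBA hneB g hg hgB hgC => ih _ (by have := card_lt_card hBA; omega)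
        (hAC.mono_left hBA.subset) hneB hneC hg hgB hgC rfl
    have hsumC := sum_swaps_numFactorizations_sub hAC.symm hneA (union_comm A C ▸ hπ) hC hA
      (by omega : k + 1 = #C + #A)
      fun B hBC hneB g hg hgB hgA => ih _ (by have := card_lt_card hBC; omega)
        (hAC.symm.mono_left hBC.subset) hneB hneA hg hgB hgA rfl
    simp only [numAnnular_comm C A] at hsumC
    have hrec (X : Finset (Perm α)) (hX : X ⊆ swaps (A ∪ C)) :
        numFactorizations X (k + 1) π = ∑ τ ∈ X, numFactorizations X k (π * τ) := by
      rw [numFactorizations_succ]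
      exact sum_congr rfl fun τ hτ => by rw [inv_eq_of_mem_swaps (hX hτ)]
    have hstep : numAnnular A C (k + 1) π =
        #A * #C * (k.factorial * treeCoeff (#A + #C)) +
          ∑ τ ∈ swaps A, numAnnular A C k (π * τ) + ∑ τ ∈ swaps C, numAnnular A C k (π * τ) := by
      rw [numAnnular, hrec _ subset_rfl, hrec _ (union_subset (swaps_mono subset_union_left)
          (swaps_mono subset_union_right)), sum_congr (swaps_union hAC) fun _ _ => rfl,
        sum_union (disjoint_crossSwaps hAC), sum_congr rfl hcross, sum_const,
        card_crossSwaps hAC, sum_union (disjoint_swaps hAC), sum_union (disjoint_swaps hAC)]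
      simp only [numAnnular, sum_sub_distrib, nsmul_eq_mul, Nat.cast_mul]
      ring
    have hkey := endoCoeff_mul_endoCoeff hA0.ne' hC0.ne'
    rw [hk, hstep, hsumA, hsumC, hkey, Nat.add_sub_cancel]
    ring

end Annulus

section Transitive
open Finset Equiv

variable {α : Type*}

theorem apply_eq_of_mem_closure {β : Type*} {f : α → β} {s : Set (Perm α)}
    (h : ∀ τ ∈ s, ∀ a, f (τ a) = f a) {g : Perm α} (hg : g ∈ Subgroup.closure s) (a : α) :
    f (g a) = f a := by
  induction hg using Subgroup.closure_induction generalizing a with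
  | mem τ hτ => exact h τ hτ a
  | one => rfl
  | mul g₁ g₂ _ _ h₁ h₂ => rw [Perm.mul_apply, h₁, h₂]
  | inv g _ hg => rw [← hg (g⁻¹ a), ← Perm.mul_apply, mul_inv_cancel, Perm.one_apply]

variable [Fintype α] [DecidableEq α]

theorem isCycleOn_cycleSet (π : Perm α) (x : α) : π.IsCycleOn (cycleSet π x) := by
  refine isCycleOn_of_mapsTo (fun y hy => ?_) fun y hy z hz => ?_
  · rw [mem_cycleSet] at hy ⊢
    exact Perm.sameCycle_apply_right.mpr hy
  · rw [mem_cycleSet] at hy hz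
    exact hy.symm.trans hz

theorem card_cycleSet (π : Perm α) (x : α) : Nat.card {z | π.SameCycle x z} = #(cycleSet π x) := by
  rw [Nat.card_coe_set_eq, ← Set.ncard_coe_finset]
  congr 1
  ext z
  simp [mem_cycleSet]

theorem mem_swaps_univ {τ : Perm α} : τ ∈ swaps univ ↔ τ.IsSwap := by
  simp [mem_swaps, Perm.IsSwap]

theorem transitive_iff_not_forall_mem {A C : Finset α} {π : Perm α} {k : ℕ}
    {w : Fin k → Perm α} (hAC : Disjoint A C) (hu : A ∪ C = univ) (hneA : A.Nonempty)
    (hneC : C.Nonempty) (hA : π.IsCycleOn A) (hC : π.IsCycleOn C)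
    (hw : w ∈ factorizations (swaps (A ∪ C)) k π) :
    (∀ a b, ∃ g ∈ Subgroup.closure (Set.range w), g a = b) ↔
      ¬ ∀ i, w i ∈ swaps A ∪ swaps C := by
  rw [mem_factorizations] at hw
  constructor
  · intro htrans hall
    obtain ⟨a, ha⟩ := hneA
    obtain ⟨c, hc⟩ := hneC
    obtain ⟨g, hg, rfl⟩ := htrans a c
    have hinv := apply_eq_of_mem_closure (f := fun x => x ∈ A) ?_ hg a
    · exact disjoint_right.mp hAC hc (hinv.mpr ha)
    · rintro _ ⟨i, rfl⟩ x
      rw [eq_iff_iff]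
      rcases mem_union.mp (hall i) with h | h
      · by_cases hx : x ∈ A
        · exact iff_of_true (supportedOn_apply_mem (swaps_subset_supportedOn _ h) hx) hx
        · rw [mem_supportedOn.mp (swaps_subset_supportedOn _ h) x hx]
      · exact apply_mem_iff_of_mem_supportedOn hAC (swaps_subset_supportedOn _ h) x
  · intro hall
    obtain ⟨i, hi⟩ := not_forall.mp hall
    have hcross := hw.1 i
    rw [swaps_union hAC, mem_union] at hcross
    have hcross := hcross.resolve_left hi
    set H := Subgroup.closure (Set.range w)
    set f : α → α → Prop := fun a b => ∃ g ∈ H, g a = b with hf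
    have hfH : ∀ σ ∈ H, ∀ a, f (σ a) = f a := fun σ hσ a => by
      funext b
      refine propext ⟨?_, ?_⟩
      · rintro ⟨g, hg, rfl⟩
        exact ⟨g * σ, mul_mem hg hσ, rfl⟩
      · rintro ⟨g, hg, rfl⟩
        exact ⟨g * σ⁻¹, mul_mem hg (inv_mem hσ), by simp⟩
    have hwH : ∀ i, w i ∈ H := fun i => Subgroup.subset_closure ⟨i, rfl⟩
    have hπ : ∀ a, f (π a) = f a := hfH π <| hw.2 ▸ Subgroup.list_prod_mem _ fun τ hτ => by
      obtain ⟨j, rfl⟩ := List.mem_ofFn.mp hτ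
      exact hwH j
    have hAC' : ∀ a ∈ A, ∀ c ∈ C, f a = f c := fun a ha c hc =>
      apply_eq_of_mem_crossSwaps hπ hA hC ha hc hcross (hfH _ (hwH i))
    obtain ⟨c₀, hc₀⟩ := hneC
    have hconst : ∀ a, f a = f c₀ := fun a => by
      rcases mem_union.mp (hu ▸ mem_univ a) with ha | ha
      · exact hAC' a ha c₀ hc₀
      · exact eq_of_sameCycle hπ (hC.2 ha hc₀)
    intro a b
    change f a b
    rw [hconst a, ← hconst b]
    exact ⟨1, one_mem H, rfl⟩

theorem card_transitive_factorizations {A C : Finset α} {π : Perm α} (hAC : Disjoint A C)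
    (hu : A ∪ C = univ) (hneA : A.Nonempty) (hneC : C.Nonempty) (hA : π.IsCycleOn A)
    (hC : π.IsCycleOn C) (k : ℕ) :
    (Nat.card {w : Fin k → Perm α // (∀ i, (w i).IsSwap) ∧ (List.ofFn w).prod = π ∧
      ∀ a b, ∃ g ∈ Subgroup.closure (Set.range w), g a = b} : ℚ) = numAnnular A C k π := by
  have hsub := factorizations_mono (union_subset (swaps_mono (S := A) (T := A ∪ C)
    subset_union_left) (swaps_mono (S := C) subset_union_right)) k π
  rw [Nat.subtype_card (factorizations (swaps (A ∪ C)) k π \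
    factorizations (swaps A ∪ swaps C) k π), cast_card_sdiff hsub]
  · rfl
  · intro w
    have hiff : w ∈ factorizations (swaps (A ∪ C)) k π ↔
        (∀ i, (w i).IsSwap) ∧ (List.ofFn w).prod = π := by
      simp only [mem_factorizations, hu, mem_swaps_univ]
    rw [mem_sdiff, ← and_assoc, ← hiff]
    refine and_congr_right fun hw => ?_
    rw [transitive_iff_not_forall_mem hAC hu hneA hneC hA hC hw, mem_factorizations,
      and_iff_left (mem_factorizations.mp hw).2]

end Transitive

end Hurwitz

/-- **The genus-0 two-part simple Hurwitz number `H_{0,2}(μ₁, μ₂)`.**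
Let `μ₁, μ₂ ≥ 1`, let `d = μ₁ + μ₂`, and let `π` be a permutation in `S_d` with exactly
two orbits on `{1,…,d}`, of sizes `μ₁` and `μ₂`.  Then the number of ordered `d`-tuples
`(τ_1, …, τ_d)` of transpositions in `S_d` with `τ_1 · τ_2 ⋯ τ_d = π` and such that the
subgroup generated by `{τ_1, …, τ_d}` acts transitively on `{1,…,d}` equals
`(μ₁ + μ₂ − 1)! · μ₁^(μ₁+1) · μ₂^(μ₂+1) / (μ₁! · μ₂!)`. -/
theorem hurwitz_H02_transposition_factorizations
    (μ₁ μ₂ : ℕ) (h₁ : 1 ≤ μ₁) (h₂ : 1 ≤ μ₂)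
    (π : Equiv.Perm (Fin (μ₁ + μ₂)))
    (horb : ∃ x y : Fin (μ₁ + μ₂),
      ¬ π.SameCycle x y ∧
      Nat.card {z : Fin (μ₁ + μ₂) | π.SameCycle x z} = μ₁ ∧
      Nat.card {z : Fin (μ₁ + μ₂) | π.SameCycle y z} = μ₂ ∧
      ∀ z : Fin (μ₁ + μ₂), π.SameCycle x z ∨ π.SameCycle y z) :
    (Nat.card {τ : Fin (μ₁ + μ₂) → Equiv.Perm (Fin (μ₁ + μ₂)) //
        (∀ i, (τ i).IsSwap) ∧ (List.ofFn τ).prod = π ∧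
        ∀ a b : Fin (μ₁ + μ₂), ∃ g ∈ Subgroup.closure (Set.range τ), g a = b} : ℚ)
      = (Nat.factorial (μ₁ + μ₂ - 1) * μ₁ ^ (μ₁ + 1) * μ₂ ^ (μ₂ + 1) : ℚ)
        / (Nat.factorial μ₁ * Nat.factorial μ₂) := by
  obtain ⟨x, y, hxy, hx, hy, hcover⟩ := horb
  rw [Hurwitz.card_cycleSet] at hx hy
  have hdisj : Disjoint (Hurwitz.cycleSet π x) (Hurwitz.cycleSet π y) :=
    Finset.disjoint_left.mpr fun z hzx hzy => by
      rw [Hurwitz.mem_cycleSet] at hzx hzy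
      exact hxy (hzx.trans hzy.symm)
  have hu : Hurwitz.cycleSet π x ∪ Hurwitz.cycleSet π y = Finset.univ := by
    ext z
    simpa [Hurwitz.mem_cycleSet] using hcover z
  have hnex : (Hurwitz.cycleSet π x).Nonempty := Finset.card_pos.mp (by omega)
  have hney : (Hurwitz.cycleSet π y).Nonempty := Finset.card_pos.mp (by omega)
  have key := Hurwitz.numAnnular_of_isCycleOn hdisj hnex hney
    (Hurwitz.mem_supportedOn.mpr fun z hz => absurd (hu ▸ Finset.mem_univ z) hz)
    (Hurwitz.isCycleOn_cycleSet π x) (Hurwitz.isCycleOn_cycleSet π y)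
  rw [hx, hy] at key
  rw [Hurwitz.card_transitive_factorizations hdisj hu hnex hney
    (Hurwitz.isCycleOn_cycleSet π x) (Hurwitz.isCycleOn_cycleSet π y), key,
    Hurwitz.endoCoeff, Hurwitz.endoCoeff]
  ring
end

section
/- Let T_x = T(X) and T_y = T(Y) denote the tree function in the two variables of the formal power series ring ℚ[[X, Y]], and let A ∈ ℚ[[X, Y]] be the double series A(X, Y) = Σ_{k,k'≥1} [ k^{k+1} · k'^{k'+1} / ((k+k') · k! · k'!) ] X^k Y^{k'}. Then the following identity holds in ℚ[[X, Y]]: (X − Y)^2 · (1 − T_x)(1 − T_y)(T_x − T_y)^2 · A = (X − Y)^2 · T_x T_y − X Y · (1 − T_x)(1 − T_y)(T_x − T_y)^2. (This is the denominator-cleared form of the identity A = T_x T_y / ((1−T_x)(1−T_y)(T_x−T_y)^2) − XY/(X−Y)^2.) -/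
open MvPowerSeries

/-- The tree function in the first variable of `ℚ[[X,Y]]`:
`T_x = Σ_{k≥1} (k^{k−1}/k!) X^k`. -/
noncomputable def treeFunX : MvPowerSeries (Fin 2) ℚ := fun d =>
  if d 1 = 0 ∧ 1 ≤ d 0 then (d 0 : ℚ) ^ (d 0 - 1) / Nat.factorial (d 0) else 0

/-- The tree function in the second variable of `ℚ[[X,Y]]`:
`T_y = Σ_{k≥1} (k^{k−1}/k!) Y^k`. -/
noncomputable def treeFunY : MvPowerSeries (Fin 2) ℚ := fun d =>
  if d 0 = 0 ∧ 1 ≤ d 1 then (d 1 : ℚ) ^ (d 1 - 1) / Nat.factorial (d 1) else 0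

/-- The genus-0 two-point Hurwitz generating series
`A(X,Y) = Σ_{k,k'≥1} k^{k+1} k'^{k'+1}/((k+k') k! k'!) X^k Y^{k'} ∈ ℚ[[X,Y]]`. -/
noncomputable def hurwitzW02 : MvPowerSeries (Fin 2) ℚ := fun d =>
  if 1 ≤ d 0 ∧ 1 ≤ d 1 then
    (d 0 : ℚ) ^ (d 0 + 1) * (d 1 : ℚ) ^ (d 1 + 1) /
      ((d 0 + d 1 : ℕ) * Nat.factorial (d 0) * Nat.factorial (d 1))
  else 0

theorem sum_choose_mul_neg_one_pow_mul_pow_pred (N M : ℕ) (h : M ≤ N) :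
    ∑ i ∈ Finset.range (N + 1),
      (M.choose i : ℚ) * (if i = 0 then 0 else (-1) ^ (M - i) * (i : ℚ) ^ (M - 1)) =
      if M = 1 then 1 else 0 := by
  have hsub : Finset.range (M + 1) ⊆ Finset.range (N + 1) := by
    intro i; simp only [Finset.mem_range]; omega
  rw [← Finset.sum_subset hsub fun i _ hi => by
    rw [Nat.choose_eq_zero_of_lt (by simpa using hi)]; simp]
  rcases M with _ | _ | M
  · simp
  · simp [Finset.sum_range_succ]
  · have key := congrFun (fwdDiff_iter_pow_eq_zero_of_lt (R := ℚ)
      (show M + 1 < M + 2 by omega)) 0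
    rw [fwdDiff_iter_eq_sum_shift] at key
    rw [if_neg (by omega)]
    refine Eq.trans (Finset.sum_congr rfl fun i _ => ?_) key
    rcases eq_or_ne i 0 with rfl | hi
    · simp
    · simp [hi]; ring

/-- A special case of Abel's binomial identity. -/
theorem sum_choose_mul_pow_pred_mul_pow (n : ℕ) (hn : n ≠ 0) :
    ∑ i ∈ Finset.range (n + 1),
      (n.choose i : ℚ) * (if i = 0 then 0 else (i : ℚ) ^ (i - 1)) * ((n - i : ℕ) : ℚ) ^ (n - i) =
      (n : ℚ) ^ n := by
  have expand : ∀ i ∈ Finset.range (n + 1),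
      (n.choose i : ℚ) * (if i = 0 then 0 else (i : ℚ) ^ (i - 1)) *
        ((n - i : ℕ) : ℚ) ^ (n - i) =
      ∑ m ∈ Finset.range (n + 1), (n.choose m : ℚ) * (n : ℚ) ^ m *
        (((n - m).choose i : ℚ) *
          (if i = 0 then 0 else (-1) ^ (n - m - i) * (i : ℚ) ^ (n - m - 1))) := by
    intro i hi
    have hin : i ≤ n := by simpa [Nat.lt_succ_iff] using hi
    have hsub : Finset.range (n - i + 1) ⊆ Finset.range (n + 1) := by
      intro i; simp only [Finset.mem_range]; omega
    rw [← Finset.sum_subset hsub fun m _ hm => by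
      rw [Nat.choose_eq_zero_of_lt (n := n - m) (by
        simp only [Finset.mem_range] at *; omega)]; simp]
    rw [Nat.cast_sub hin, sub_eq_add_neg, add_pow, Finset.mul_sum]
    refine Finset.sum_congr rfl fun m hm => ?_
    have hm' : m + i ≤ n := by simp only [Finset.mem_range] at hm; omega
    have hc : (n.choose i : ℚ) * ((n - i).choose m : ℚ) = n.choose m * (n - m).choose i := by
      have h1 := Nat.choose_mul (n := n) (k := m + i) (s := i) (by omega)
      have h2 := Nat.choose_mul (n := n) (k := m + i) (s := m) (by omega)
      have h3 : (m + i).choose i = (m + i).choose m := Nat.choose_symm_add.symm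
      simp only [Nat.add_sub_cancel, Nat.add_sub_cancel_left] at h1 h2
      rw [h3] at h1
      exact_mod_cast h1.symm.trans h2
    rcases eq_or_ne i 0 with rfl | hi0
    · simp
    · simp only [hi0, if_false]
      have hp : (-(i : ℚ)) ^ (n - i - m) * (i : ℚ) ^ (i - 1) =
          (-1) ^ (n - m - i) * (i : ℚ) ^ (n - m - 1) := by
        rw [neg_pow, mul_assoc, ← pow_add]
        congr 2 <;> omega
      linear_combination (n : ℚ) ^ m * ((-(i : ℚ)) ^ (n - i - m) * (i : ℚ) ^ (i - 1)) * hc +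
        (n : ℚ) ^ m * (n.choose m * (n - m).choose i) * hp
  rw [Finset.sum_congr rfl expand, Finset.sum_comm]
  simp_rw [← Finset.mul_sum]
  rw [Finset.sum_congr rfl fun m _ => by
    rw [sum_choose_mul_neg_one_pow_mul_pow_pred n (n - m) (by omega)]]
  obtain ⟨k, rfl⟩ := Nat.exists_eq_succ_of_ne_zero hn
  rw [Finset.sum_eq_single k]
  · simp [pow_succ]; ring
  · intro b hb hbk
    rw [if_neg (by simp only [Finset.mem_range] at hb; omega), mul_zero]
  · simp

namespace PowerSeries

/-- The tree function `∑_{k ≥ 1} k ^ (k - 1) / k! X ^ k`. -/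
noncomputable def treeFun : PowerSeries ℚ :=
  mk fun k => if k = 0 then 0 else (k : ℚ) ^ (k - 1) / Nat.factorial k

/-- The series `∑_{k ≥ 0} k ^ k / k! X ^ k`. -/
noncomputable def endofunctionSeries : PowerSeries ℚ :=
  mk fun k => (k : ℚ) ^ k / Nat.factorial k

theorem treeFun_mul_endofunctionSeries :
    treeFun * endofunctionSeries = endofunctionSeries - 1 := by
  ext n
  rw [coeff_mul, Finset.Nat.sum_antidiagonal_eq_sum_range_succ_mk]
  rcases eq_or_ne n 0 with rfl | hn
  · simp [treeFun, endofunctionSeries]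
  · have h0 : (n.factorial : ℚ) ≠ 0 := by positivity
    simp only [treeFun, endofunctionSeries, coeff_mk, map_sub, coeff_one, hn, if_false, sub_zero]
    rw [← sum_choose_mul_pow_pred_mul_pow n hn, Finset.sum_div]
    refine Finset.sum_congr rfl fun i hi => ?_
    rw [Nat.cast_choose ℚ (show i ≤ n by simpa [Nat.lt_succ_iff] using hi)]
    split_ifs
    · simp
    · field_simp

end PowerSeries

namespace MvPowerSeries

variable {σ R : Type*}

/-- The Euler derivation, multiplying each homogeneous component by its degree. -/
noncomputable def euler [CommRing R] : Derivation R (MvPowerSeries σ R) (MvPowerSeries σ R) where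
  toFun f := fun d => (d.degree : R) * coeff d f
  map_add' f g := by
    ext d
    change (d.degree : R) * coeff d (f + g) = d.degree * coeff d f + d.degree * coeff d g
    rw [map_add, mul_add]
  map_smul' r f := by
    ext d
    change (d.degree : R) * coeff d (r • f) = r * (d.degree * coeff d f)
    rw [coeff_smul, mul_left_comm]
  map_one_eq_zero' := by
    classical
    ext d
    change (d.degree : R) * coeff d 1 = 0
    rw [coeff_one]
    split_ifs with h
    · simp [h]
    · simp
  leibniz' f g := by
    classical
    ext d
    change (d.degree : R) * coeff d (f * g) = coeff d (f * _ + g * _)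
    rw [mul_comm g, map_add, coeff_mul, coeff_mul, coeff_mul, Finset.mul_sum,
      ← Finset.sum_add_distrib]
    refine Finset.sum_congr rfl fun p hp => ?_
    rw [← Finset.HasAntidiagonal.mem_antidiagonal.1 hp, map_add, Nat.cast_add]
    change _ = coeff p.1 f * ((p.2.degree : R) * coeff p.2 g) +
      (p.1.degree : R) * coeff p.1 f * coeff p.2 g
    ring

theorem coeff_euler [CommRing R] (f : MvPowerSeries σ R) (d : σ →₀ ℕ) :
    coeff d (euler f) = (d.degree : R) * coeff d f := rfl

theorem euler_X [CommRing R] (i : σ) : euler (X i : MvPowerSeries σ R) = X i := by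
  classical
  ext d
  rw [coeff_euler, coeff_X]
  split_ifs with h
  · simp [h]
  · simp

theorem coeff_mul_of_degree_le_order [CommSemiring R] (w f : MvPowerSeries σ R) {d : σ →₀ ℕ}
    (h : (d.degree : ℕ∞) ≤ f.order) : coeff d (w * f) = constantCoeff w * coeff d f := by
  classical
  rw [coeff_mul, Finset.sum_eq_single (0, d)]
  · simp
  · rintro ⟨a, b⟩ hab hne
    have hab' : a + b = d := Finset.HasAntidiagonal.mem_antidiagonal.1 hab
    have ha : a ≠ 0 := by
      rintro rfl
      exact hne (by simpa using hab')
    have hlt : b.degree < d.degree := by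
      rw [← hab', map_add]
      have : a.degree ≠ 0 := (Finsupp.degree_eq_zero_iff a).not.2 ha
      omega
    rw [coeff_of_lt_order (f := f) (lt_of_lt_of_le (by exact_mod_cast hlt) h), mul_zero]
  · simp

theorem eq_zero_of_mul_euler_eq [CommRing R] [IsDomain R] [CharZero R]
    {w c f : MvPowerSeries σ R} {k : ℕ}
    (hw : constantCoeff w = 1) (hc : constantCoeff c = k) (hf : ((k + 1 : ℕ) : ℕ∞) ≤ f.order)
    (h : w * euler f = c * f) : f = 0 := by
  by_contra hne
  obtain ⟨d, hd, hdo⟩ := exists_coeff_ne_zero_and_order (ne_zero_iff_order_finite.1 hne)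
  have he : (d.degree : ℕ∞) ≤ (euler f).order := by
    refine le_order fun e he => ?_
    rw [coeff_euler, coeff_of_lt_order (f := f) (hdo ▸ he), mul_zero]
  have hco := congrArg (coeff d) h
  rw [coeff_mul_of_degree_le_order _ _ he, coeff_mul_of_degree_le_order _ _ hdo.le, hw, hc,
    coeff_euler, one_mul] at hco
  have hk : d.degree = k := by exact_mod_cast mul_right_cancel₀ hd hco
  rw [← hdo, hk] at hf
  have : k + 1 ≤ k := by exact_mod_cast hf
  omega

/-- A univariate power series, viewed as a power series in the variable `X i`. -/
noncomputable def inVar [CommRing R] (i : σ) : PowerSeries R →ₐ[R] MvPowerSeries σ R :=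
  rename (⟨fun _ => i, Function.injective_of_subsingleton _⟩ : Unit ↪ σ)

theorem coeff_single_inVar [CommRing R] (i : σ) (f : PowerSeries R) (n : ℕ) :
    coeff (Finsupp.single i n) (inVar i f) = PowerSeries.coeff n f := by
  have := coeff_embDomain_rename (⟨fun _ => i, Function.injective_of_subsingleton _⟩ : Unit ↪ σ) f
    (Finsupp.single () n)
  rw [Finsupp.embDomain_single] at this
  exact this

theorem coeff_inVar_of_ne [CommRing R] (i : σ) (f : PowerSeries R) {d : σ →₀ ℕ}
    (h : d ≠ Finsupp.single i (d i)) : coeff d (inVar i f) = 0 := by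
  refine coeff_rename_eq_zero _ f ?_
  rintro ⟨x, rfl⟩
  obtain ⟨n, rfl⟩ : ∃ n, x = Finsupp.single () n := ⟨x (), by ext; simp⟩
  apply h
  rw [Finsupp.mapDomain_single]
  change Finsupp.single i n = Finsupp.single i (Finsupp.single i n i)
  rw [Finsupp.single_eq_same]

theorem coeff_inVar_zero_mul_inVar_one [CommRing R] (f g : PowerSeries R) (d : Fin 2 →₀ ℕ) :
    coeff d (inVar 0 f * inVar 1 g) = PowerSeries.coeff (d 0) f * PowerSeries.coeff (d 1) g := by
  rw [coeff_mul, Finset.sum_eq_single (Finsupp.single 0 (d 0), Finsupp.single 1 (d 1))]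
  · simp only [coeff_single_inVar]
  · rintro ⟨a, b⟩ hab hne
    have hab' : a + b = d := Finset.HasAntidiagonal.mem_antidiagonal.1 hab
    by_cases ha : a = Finsupp.single 0 (a 0)
    · by_cases hb : b = Finsupp.single 1 (b 1)
      · refine absurd ?_ hne
        rw [ha, hb] at hab'
        rw [← hab', ha, hb]
        simp
      · rw [coeff_inVar_of_ne 1 g hb, mul_zero]
    · rw [coeff_inVar_of_ne 0 f ha, zero_mul]
  · intro h
    refine absurd (Finset.HasAntidiagonal.mem_antidiagonal.2 ?_) h
    ext i
    fin_cases i <;> simp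

theorem euler_inVar [CommRing R] (i : σ) (f : PowerSeries R) :
    euler (inVar i f) = inVar i (PowerSeries.mk fun n => (n : R) * PowerSeries.coeff n f) := by
  ext d
  rw [coeff_euler]
  by_cases h : d = Finsupp.single i (d i)
  · rw [h, coeff_single_inVar, coeff_single_inVar]
    simp
  · rw [coeff_inVar_of_ne i _ h, coeff_inVar_of_ne i _ h, mul_zero]

theorem one_sub_mul_euler_inVar_treeFun (i : σ) :
    (1 - inVar i PowerSeries.treeFun) * euler (inVar i PowerSeries.treeFun) =
      inVar i PowerSeries.treeFun := by
  have h : (PowerSeries.mk fun n => (n : ℚ) * PowerSeries.coeff n PowerSeries.treeFun) =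
      PowerSeries.endofunctionSeries - 1 := by
    ext n
    rcases n with _ | n
    · simp [PowerSeries.endofunctionSeries]
    · simp [PowerSeries.endofunctionSeries, PowerSeries.treeFun, PowerSeries.coeff_one, pow_succ]
      ring
  rw [euler_inVar, h, ← map_one (inVar i), ← map_sub, ← map_mul]
  congr 1
  linear_combination -PowerSeries.treeFun_mul_endofunctionSeries

theorem one_sub_pow_mul_euler_euler_inVar_treeFun (i : σ) :
    (1 - inVar i PowerSeries.treeFun) ^ 3 * euler (euler (inVar i PowerSeries.treeFun)) =
      inVar i PowerSeries.treeFun := by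
  have h := one_sub_mul_euler_inVar_treeFun i
  have h' := congrArg euler h
  simp only [Derivation.leibniz, map_sub, Derivation.map_one_eq_zero, smul_eq_mul] at h'
  set t := inVar i PowerSeries.treeFun
  linear_combination (1 - t) ^ 2 * h' + (1 - t) * h + ((1 - t) * euler t + t) * h

theorem two_le_order_inVar_treeFun_sub_X (i : σ) :
    2 ≤ (inVar i PowerSeries.treeFun - X i).order := by
  classical
  refine nat_le_order fun d hd => ?_
  rw [map_sub]
  by_cases h : d = Finsupp.single i (d i)
  · have : d i < 2 := by rw [h] at hd; simpa using hd
    rw [h, coeff_single_inVar, coeff_X]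
    interval_cases d i
    · simp [PowerSeries.treeFun, eq_comm (a := (0 : σ →₀ ℕ))]
    · simp [PowerSeries.treeFun]
  · rw [coeff_inVar_of_ne i _ h, coeff_X, if_neg, sub_zero]
    rintro rfl
    simp at h

theorem constantCoeff_inVar_treeFun (i : σ) :
    constantCoeff (inVar i PowerSeries.treeFun) = 0 := by
  rw [← coeff_zero_eq_constantCoeff_apply, ← Finsupp.single_zero i, coeff_single_inVar]
  simp [PowerSeries.treeFun]

theorem le_order_mul_of_le [CommRing R] {f g : MvPowerSeries σ R} {m n : ℕ∞}
    (hf : m ≤ f.order) (hg : n ≤ g.order) : m + n ≤ (f * g).order :=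
  (add_le_add hf hg).trans le_order_mul

theorem le_order_add_of_le [CommRing R] {f g : MvPowerSeries σ R} {n : ℕ∞}
    (hf : n ≤ f.order) (hg : n ≤ g.order) : n ≤ (f + g).order :=
  (le_min hf hg).trans min_order_le_add

theorem le_order_sub_of_le [CommRing R] {f g : MvPowerSeries σ R} {n : ℕ∞}
    (hf : n ≤ f.order) (hg : n ≤ g.order) : n ≤ (f - g).order := by
  rw [sub_eq_add_neg]
  exact le_order_add_of_le hf (by rwa [order_neg])

end MvPowerSeries

theorem treeFunX_eq_inVar : treeFunX = inVar 0 PowerSeries.treeFun := by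
  ext d
  change (if d 1 = 0 ∧ 1 ≤ d 0 then (d 0 : ℚ) ^ (d 0 - 1) / Nat.factorial (d 0) else 0) = _
  by_cases h : d = Finsupp.single 0 (d 0)
  · have h1 : d 1 = 0 := by rw [h]; simp
    conv_rhs => rw [h, coeff_single_inVar]
    simp [PowerSeries.treeFun, h1, Nat.one_le_iff_ne_zero, ite_not]
  · rw [coeff_inVar_of_ne 0 _ h, if_neg]
    rintro ⟨h1, -⟩
    apply h
    ext i
    fin_cases i <;> simp [h1]

theorem treeFunY_eq_inVar : treeFunY = inVar 1 PowerSeries.treeFun := by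
  ext d
  change (if d 0 = 0 ∧ 1 ≤ d 1 then (d 1 : ℚ) ^ (d 1 - 1) / Nat.factorial (d 1) else 0) = _
  by_cases h : d = Finsupp.single 1 (d 1)
  · have h1 : d 0 = 0 := by rw [h]; simp
    conv_rhs => rw [h, coeff_single_inVar]
    simp [PowerSeries.treeFun, h1, Nat.one_le_iff_ne_zero, ite_not]
  · rw [coeff_inVar_of_ne 1 _ h, if_neg]
    rintro ⟨h1, -⟩
    apply h
    ext i
    fin_cases i <;> simp [h1]

theorem coeff_hurwitzW02 (d : Fin 2 →₀ ℕ) :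
    coeff d hurwitzW02 = if 1 ≤ d 0 ∧ 1 ≤ d 1 then
      (d 0 : ℚ) ^ (d 0 + 1) * (d 1 : ℚ) ^ (d 1 + 1) /
        ((d 0 + d 1 : ℕ) * Nat.factorial (d 0) * Nat.factorial (d 1))
    else 0 := rfl

theorem euler_hurwitzW02 :
    euler hurwitzW02 = euler (euler treeFunX) * euler (euler treeFunY) := by
  rw [treeFunX_eq_inVar, treeFunY_eq_inVar]
  simp only [euler_inVar]
  ext d
  rw [coeff_euler, coeff_inVar_zero_mul_inVar_one]
  have hdeg : d.degree = d 0 + d 1 := by simp [Finsupp.degree_eq_sum]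
  rw [hdeg, coeff_hurwitzW02]
  simp only [PowerSeries.coeff_mk, PowerSeries.treeFun]
  rcases d 0 with _ | m
  · simp
  rcases d 1 with _ | n
  · simp
  have hm : ((m + 1).factorial : ℚ) ≠ 0 := by positivity
  have hn : ((n + 1).factorial : ℚ) ≠ 0 := by positivity
  have hmn : ((m + 1 + (n + 1) : ℕ) : ℚ) ≠ 0 := by positivity
  rw [if_pos (by omega), if_neg (by omega), if_neg (by omega)]
  simp only [Nat.add_sub_cancel]
  field_simp
  ring

theorem five_le_order_closed_form {x y tx ty a : MvPowerSeries (Fin 2) ℚ}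
    (hx : 1 ≤ x.order) (hy : 1 ≤ y.order) (htx : 2 ≤ (tx - x).order) (hty : 2 ≤ (ty - y).order)
    (ha : 1 ≤ a.order) :
    5 ≤ ((x - y) ^ 2 * ((1 - tx) * (1 - ty) * (tx - ty) ^ 2) * a -
      ((x - y) ^ 2 * (tx * ty) - x * y * ((1 - tx) * (1 - ty) * (tx - ty) ^ 2))).order := by
  have h12 : (1 : ℕ∞) ≤ 2 := by norm_num
  have htx' : 1 ≤ tx.order := by
    simpa using le_order_add_of_le (h12.trans htx) hx
  have hty' : 1 ≤ ty.order := by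
    simpa using le_order_add_of_le (h12.trans hty) hy
  have hnonneg : ∀ f : MvPowerSeries (Fin 2) ℚ, 0 ≤ f.order := fun _ => zero_le
  have hxy := le_order_sub_of_le hx hy
  have htxy := le_order_sub_of_le htx' hty'
  have hpq := le_order_sub_of_le htx hty
  have hP := le_order_mul_of_le (le_order_mul_of_le (le_order_mul_of_le hxy hxy)
    (le_order_mul_of_le (le_order_mul_of_le (hnonneg (1 - tx)) (hnonneg (1 - ty)))
      (le_order_mul_of_le htxy htxy))) ha
  have h1 := le_order_mul_of_le (le_order_mul_of_le hxy hxy) (le_order_add_of_le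
    (le_order_mul_of_le htx hty') ((le_order_mul_of_le hx hty).trans' (by norm_num)))
  have h2 := le_order_mul_of_le (le_order_mul_of_le hx hy)
    (le_order_mul_of_le hpq (le_order_add_of_le htxy hxy))
  have h3 := le_order_mul_of_le (le_order_mul_of_le hx hy) (le_order_mul_of_le
    (le_order_add_of_le htx' ((le_order_mul_of_le (hnonneg (1 - tx)) hty').trans' (by norm_num)))
    (le_order_mul_of_le htxy htxy))
  norm_num at hP h1 h2 h3
  refine (le_order_sub_of_le hP (le_order_sub_of_le h1 (le_order_sub_of_le h2 h3))).trans_eq ?_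
  congr 1
  ring

/-- **Closed form of the genus-0 two-point Hurwitz generating function**
(Goulden–Jackson–Vainshtein), in denominator-cleared form: in `ℚ[[X,Y]]`,
`(X−Y)² (1−T_x)(1−T_y)(T_x−T_y)² · A = (X−Y)² T_x T_y − XY (1−T_x)(1−T_y)(T_x−T_y)²`,
i.e. `A = T_x T_y/((1−T_x)(1−T_y)(T_x−T_y)²) − XY/(X−Y)²`. -/
theorem hurwitzW02_closed_form :
    (MvPowerSeries.X (0 : Fin 2) - MvPowerSeries.X 1) ^ 2 *
        ((1 - treeFunX) * (1 - treeFunY) * (treeFunX - treeFunY) ^ 2) * hurwitzW02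
      = (MvPowerSeries.X (0 : Fin 2) - MvPowerSeries.X 1) ^ 2 * (treeFunX * treeFunY)
        - MvPowerSeries.X (0 : Fin 2) * MvPowerSeries.X 1 *
          ((1 - treeFunX) * (1 - treeFunY) * (treeFunX - treeFunY) ^ 2) := by
  have hx : euler (X 0 : MvPowerSeries (Fin 2) ℚ) = X 0 := euler_X 0
  have hy : euler (X 1 : MvPowerSeries (Fin 2) ℚ) = X 1 := euler_X 1
  have ha : (1 - treeFunX) * euler treeFunX = treeFunX :=
    treeFunX_eq_inVar ▸ one_sub_mul_euler_inVar_treeFun 0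
  have hb : (1 - treeFunY) * euler treeFunY = treeFunY :=
    treeFunY_eq_inVar ▸ one_sub_mul_euler_inVar_treeFun 1
  have ha' : (1 - treeFunX) ^ 3 * euler (euler treeFunX) = treeFunX :=
    treeFunX_eq_inVar ▸ one_sub_pow_mul_euler_euler_inVar_treeFun 0
  have hb' : (1 - treeFunY) ^ 3 * euler (euler treeFunY) = treeFunY :=
    treeFunY_eq_inVar ▸ one_sub_pow_mul_euler_euler_inVar_treeFun 1
  have hA : (1 - treeFunX) ^ 3 * (1 - treeFunY) ^ 3 * euler hurwitzW02 = treeFunX * treeFunY := by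
    rw [euler_hurwitzW02]
    linear_combination (1 - treeFunY) ^ 3 * euler (euler treeFunY) * ha' + treeFunX * hb'
  have oX : ∀ i : Fin 2, 1 ≤ (X i : MvPowerSeries (Fin 2) ℚ).order := fun i =>
    one_le_order_iff_constCoeff_eq_zero.2 (constantCoeff_X i)
  have oTx : 2 ≤ (treeFunX - X 0).order :=
    treeFunX_eq_inVar ▸ two_le_order_inVar_treeFun_sub_X 0
  have oTy : 2 ≤ (treeFunY - X 1).order :=
    treeFunY_eq_inVar ▸ two_le_order_inVar_treeFun_sub_X 1
  have cTx : constantCoeff treeFunX = 0 := by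
    rw [treeFunX_eq_inVar]; exact constantCoeff_inVar_treeFun 0
  have cTy : constantCoeff treeFunY = 0 := by
    rw [treeFunY_eq_inVar]; exact constantCoeff_inVar_treeFun 1
  have cA : coeff 0 hurwitzW02 = 0 := by simp [coeff_hurwitzW02]
  have oA : 1 ≤ hurwitzW02.order :=
    one_le_order_iff_constCoeff_eq_zero.2 cA
  rw [← sub_eq_zero]
  refine eq_zero_of_mul_euler_eq (k := 4)
    (w := (1 - treeFunX) ^ 2 * (1 - treeFunY) ^ 2)
    (c := 2 * (1 - treeFunX) ^ 2 * (1 - treeFunY) ^ 2 - treeFunX * (1 - treeFunY) ^ 2 -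
      treeFunY * (1 - treeFunX) ^ 2 + 2 * (1 - treeFunX) * (1 - treeFunY))
    (by simp [cTx, cTy]) (by simp [cTx, cTy, map_ofNat constantCoeff 2]; norm_num)
    (five_le_order_closed_form (oX 0) (oX 1) oTx oTy oA) ?_
  simp only [Derivation.leibniz, Derivation.leibniz_pow, map_sub, Derivation.map_one_eq_zero,
    smul_eq_mul, nsmul_eq_mul, hx, hy]
  generalize treeFunX = s at *
  generalize treeFunY = t at *
  generalize hurwitzW02 = A at *
  generalize euler s = a at *
  generalize euler t = b at *
  generalize euler A = G at *
  generalize (X 0 : MvPowerSeries (Fin 2) ℚ) = x at *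
  generalize (X 1 : MvPowerSeries (Fin 2) ℚ) = y at *
  push_cast
  linear_combination
    (1 - s) * (1 - t) ^ 2 *
      (A * (x - y) ^ 2 * (2 * (1 - s) * (1 - t) * (s - t) - (1 - t) * (s - t) ^ 2) -
        (x - y) ^ 2 * t +
        x * y * (2 * (1 - s) * (1 - t) * (s - t) - (1 - t) * (s - t) ^ 2)) * ha +
    (1 - s) ^ 2 * (1 - t) *
      (A * (x - y) ^ 2 * (-2 * (1 - s) * (1 - t) * (s - t) - (1 - s) * (s - t) ^ 2) -
        (x - y) ^ 2 * s +
        x * y * (-2 * (1 - s) * (1 - t) * (s - t) - (1 - s) * (s - t) ^ 2)) * hb +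
    (x - y) ^ 2 * (s - t) ^ 2 * hA
end
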